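/- arXiv:1503.09174 — 2 statements merged into one kernel-verified Lean document; each statement's English description precedes it below -/
import Mathlib

section
/- Let A ⊆ ℕ be a nonempty set with A ≠ {1}, let d = gcd(A), and set Φ(z) = 1 + Σ_{k∈A} z^k. Then, as n → ∞ along multiples of d, #ℕℂ^A_n is asymptotically equivalent to d · √(Φ(ξ_A)/(2π·Φ''(ξ_A))) · (Φ(ξ_A)/ξ_A)^{n+1} · n^{−3/2}, i.e. the ratio of #ℕℂ^A_n to this quantity tends to 1 as n → ∞ with d dividing n. -/
open scoped Classical

/-- `P` is a set partition of `[n] = {1, …, n}`: its blocks are nonempty subsets of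
`{1, …, n}` and every element of `{1, …, n}` lies in exactly one block. -/
def IsPartitionOf (n : ℕ) (P : Finset (Finset ℕ)) : Prop :=
  (∀ B ∈ P, B ⊆ Finset.Icc 1 n ∧ B.Nonempty) ∧
    ∀ x ∈ Finset.Icc 1 n, ∃! B, B ∈ P ∧ x ∈ B

/-- A partition is non-crossing when there are no `a < b < c < d` with `a, c` in one
block and `b, d` in another, distinct block. -/
def IsNonCrossing (P : Finset (Finset ℕ)) : Prop :=
  ∀ B ∈ P, ∀ B' ∈ P, B ≠ B' →
    ∀ a b c d : ℕ, a < b → b < c → c < d →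
      a ∈ B → c ∈ B → b ∈ B' → d ∈ B' → False

/-- The (finite) set of non-crossing partitions of `[n]`. -/
noncomputable def NCP (n : ℕ) : Finset (Finset (Finset ℕ)) :=
  (Finset.Icc 1 n).powerset.powerset.filter fun P => IsPartitionOf n P ∧ IsNonCrossing P

/-- The set of non-crossing partitions of `[n]` all of whose block sizes belong to `A`. -/
noncomputable def NCPA (A : Set ℕ) (n : ℕ) : Finset (Finset (Finset ℕ)) :=
  (NCP n).filter fun P => ∀ B ∈ P, B.card ∈ A

/-- The probability measure `π_A` on `ℤ₊` associated with `A` and `ξ = ξ_A`. -/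
noncomputable def piA (A : Set ℕ) (ξ : ℝ) (k : ℕ) : ℝ :=
  if k = 0 ∨ k ∈ A then ξ ^ k / (1 + ∑' i : A, ξ ^ (i : ℕ)) else 0

/-- `P` is a non-crossing partition of the integer interval `(a, b]` whose block sizes all
belong to `A`. -/
structure IsNCOn (A : Set ℕ) (a b : ℕ) (P : Finset (Finset ℕ)) : Prop where
  sub : ∀ B ∈ P, ∀ x ∈ B, a < x ∧ x ≤ b
  nonempty : ∀ B ∈ P, B.Nonempty
  card_mem : ∀ B ∈ P, B.card ∈ A
  cover : ∀ x, a < x → x ≤ b → ∃ B ∈ P, x ∈ B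
  disj : ∀ B ∈ P, ∀ C ∈ P, ∀ x ∈ B, x ∈ C → B = C
  nc : ∀ B ∈ P, ∀ C ∈ P, ∀ x y z w : ℕ, x < y → y < z → z < w →
    x ∈ B → z ∈ B → y ∈ C → w ∈ C → B = C

/-- `B` together with the blocks in `P` forms a non-crossing partition of `[n]`, the block `B`
contains `n` (and is empty if `n = 0`), and all block sizes except possibly that of `B` belong
to `A`. -/
structure IsRooted (A : Set ℕ) (n : ℕ) (B : Finset ℕ) (P : Finset (Finset ℕ)) : Prop where
  root : n = 0 ∨ n ∈ B
  sub_root : ∀ x ∈ B, 0 < x ∧ x ≤ n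
  sub : ∀ C ∈ P, ∀ x ∈ C, 0 < x ∧ x ≤ n
  nonempty : ∀ C ∈ P, C.Nonempty
  card_mem : ∀ C ∈ P, C.card ∈ A
  cover : ∀ x, 0 < x → x ≤ n → x ∈ B ∨ ∃ C ∈ P, x ∈ C
  disj_root : ∀ C ∈ P, ∀ x ∈ B, x ∉ C
  disj : ∀ C ∈ P, ∀ D ∈ P, ∀ x ∈ C, x ∈ D → C = D
  nc_root : ∀ C ∈ P, ∀ x y z w : ℕ, x < y → y < z → z < w →
    x ∈ B → z ∈ B → y ∈ C → w ∈ C → False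
  nc_root' : ∀ C ∈ P, ∀ x y z w : ℕ, x < y → y < z → z < w →
    x ∈ C → z ∈ C → y ∈ B → w ∈ B → False
  nc : ∀ C ∈ P, ∀ D ∈ P, ∀ x y z w : ℕ, x < y → y < z → z < w →
    x ∈ C → z ∈ C → y ∈ D → w ∈ D → C = D

/-- The finite set of non-crossing partitions of `(a, b]` with block sizes in `A`. -/
noncomputable def ncOn (A : Set ℕ) (a b : ℕ) : Finset (Finset (Finset ℕ)) :=
  (Finset.Icc 1 b).powerset.powerset.filter (IsNCOn A a b)

/-- The finite set of rooted non-crossing partitions of `[n]` with root block of size `k`. -/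
noncomputable def rooted (A : Set ℕ) (n k : ℕ) : Finset (Finset ℕ × Finset (Finset ℕ)) :=
  ((Finset.Icc 1 n).powerset ×ˢ (Finset.Icc 1 n).powerset.powerset).filter
    fun q => IsRooted A n q.1 q.2 ∧ q.1.card = k

theorem mem_ncOn {A : Set ℕ} {a b : ℕ} {P : Finset (Finset ℕ)} :
    P ∈ ncOn A a b ↔ IsNCOn A a b P := by
  simp only [ncOn, Finset.mem_filter, Finset.mem_powerset, and_iff_right_iff_imp]
  intro h B hB
  rw [Finset.mem_powerset]
  intro x hx
  have := h.sub B hB x hx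
  rw [Finset.mem_Icc]
  lia

theorem mem_rooted {A : Set ℕ} {n k : ℕ} {q : Finset ℕ × Finset (Finset ℕ)} :
    q ∈ rooted A n k ↔ IsRooted A n q.1 q.2 ∧ q.1.card = k := by
  simp only [rooted, Finset.mem_filter, Finset.mem_powerset, Finset.mem_product,
    and_iff_right_iff_imp]
  rintro ⟨h, -⟩
  refine ⟨fun x hx => ?_, fun B hB => ?_⟩
  · have := h.sub_root x hx
    rw [Finset.mem_Icc]
    lia
  · rw [Finset.mem_powerset]
    intro x hx
    have := h.sub B hB x hx
    rw [Finset.mem_Icc]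
    lia

theorem ncOn_zero_eq_NCPA (A : Set ℕ) (n : ℕ) : ncOn A 0 n = NCPA A n := by
  ext P
  simp only [mem_ncOn, NCPA, NCP, Finset.mem_filter, Finset.mem_powerset]
  constructor
  · intro h
    have hsub : ∀ B ∈ P, B ⊆ Finset.Icc 1 n := by
      intro B hB x hx
      have := h.sub B hB x hx
      rw [Finset.mem_Icc]
      lia
    refine ⟨⟨fun B hB => Finset.mem_powerset.2 (hsub B hB),
      ⟨fun B hB => ⟨hsub B hB, h.nonempty B hB⟩, fun x hx => ?_⟩, ?_⟩, h.card_mem⟩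
    · rw [Finset.mem_Icc] at hx
      obtain ⟨B, hB, hxB⟩ := h.cover x (by lia) hx.2
      exact ⟨B, ⟨hB, hxB⟩, fun C hC => h.disj C hC.1 B hB x hC.2 hxB⟩
    · intro B hB C hC hne x y z w h1 h2 h3 h4 h5 h6 h7
      exact hne (h.nc B hB C hC x y z w h1 h2 h3 h4 h5 h6 h7)
  · rintro ⟨⟨-, ⟨h1, h2⟩, h3⟩, h4⟩
    refine ⟨fun B hB x hx => ?_, fun B hB => (h1 B hB).2, h4, fun x h0 hn => ?_, ?_, ?_⟩
    · have := (h1 B hB).1 hx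
      rw [Finset.mem_Icc] at this
      lia
    · obtain ⟨B, hB, -⟩ := h2 x (Finset.mem_Icc.2 ⟨h0, hn⟩)
      exact ⟨B, hB⟩
    · intro B hB C hC x hxB hxC
      exact (h2 x ((h1 B hB).1 hxB)).unique ⟨hB, hxB⟩ ⟨hC, hxC⟩
    · intro B hB C hC x y z w h5 h6 h7 h8 h9 h10 h11
      by_contra hne
      exact h3 B hB C hC hne x y z w h5 h6 h7 h8 h9 h10 h11

theorem IsNCOn.shift {A : Set ℕ} {a n : ℕ} {P : Finset (Finset ℕ)} (h : IsNCOn A 0 n P) :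
    IsNCOn A a (a + n) (P.image (Finset.image (a + ·))) := by
  have hinj : Function.Injective (a + · : ℕ → ℕ) := add_right_injective a
  constructor
  · simp only [Finset.forall_mem_image]
    intro B hB x hx
    have := h.sub B hB x hx
    lia
  · simp only [Finset.forall_mem_image]
    intro B hB
    exact (h.nonempty B hB).image _
  · simp only [Finset.forall_mem_image]
    intro B hB
    rw [Finset.card_image_of_injective _ hinj]
    exact h.card_mem B hB
  · intro x h1 h2
    obtain ⟨B, hB, hx⟩ := h.cover (x - a) (by lia) (by lia)
    refine ⟨_, Finset.mem_image_of_mem _ hB, Finset.mem_image.2 ⟨x - a, hx, by lia⟩⟩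
  · simp only [Finset.forall_mem_image]
    intro B hB C hC x hx hx'
    rw [hinj.mem_finset_image] at hx'
    rw [h.disj B hB C hC x hx hx']
  · simp only [Finset.forall_mem_image]
    intro B hB C hC x y z w h1 h2 h3 hx hz hy hw
    simp only [Finset.mem_image] at hx hy hz hw
    obtain ⟨x, hx, rfl⟩ := hx
    obtain ⟨y, hy, rfl⟩ := hy
    obtain ⟨z, hz, rfl⟩ := hz
    obtain ⟨w, hw, rfl⟩ := hw
    rw [h.nc B hB C hC x y z w (by lia) (by lia) (by lia) hx hz hy hw]

theorem IsNCOn.unshift {A : Set ℕ} {a n : ℕ} {P : Finset (Finset ℕ)} (h : IsNCOn A a (a + n) P) :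
    IsNCOn A 0 n (P.image (Finset.image (· - a))) := by
  have hmem : ∀ B ∈ P, ∀ x, x ∈ B.image (· - a) → a + x ∈ B := by
    intro B hB x hx
    obtain ⟨y, hy, rfl⟩ := Finset.mem_image.1 hx
    have := h.sub B hB y hy
    rwa [Nat.add_sub_cancel' (by lia)]
  constructor
  · simp only [Finset.forall_mem_image]
    intro B hB x hx
    have := h.sub B hB x hx
    lia
  · simp only [Finset.forall_mem_image]
    intro B hB
    exact (h.nonempty B hB).image _
  · simp only [Finset.forall_mem_image]
    intro B hB
    rw [Finset.card_image_of_injOn]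
    · exact h.card_mem B hB
    · intro x hx y hy hxy
      have := h.sub B hB x hx
      have := h.sub B hB y hy
      simp only at hxy
      lia
  · intro x h1 h2
    obtain ⟨B, hB, hx⟩ := h.cover (a + x) (by lia) (by lia)
    refine ⟨_, Finset.mem_image_of_mem _ hB, Finset.mem_image.2 ⟨a + x, hx, by lia⟩⟩
  · intro B' hB' C' hC' x hx hx'
    obtain ⟨B, hB, rfl⟩ := Finset.mem_image.1 hB'
    obtain ⟨C, hC, rfl⟩ := Finset.mem_image.1 hC'
    rw [h.disj B hB C hC _ (hmem B hB x hx) (hmem C hC x hx')]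
  · intro B' hB' C' hC' x y z w h1 h2 h3 hx hz hy hw
    obtain ⟨B, hB, rfl⟩ := Finset.mem_image.1 hB'
    obtain ⟨C, hC, rfl⟩ := Finset.mem_image.1 hC'
    rw [h.nc B hB C hC (a + x) (a + y) (a + z) (a + w) (by lia) (by lia) (by lia)
      (hmem _ hB _ hx) (hmem _ hB _ hz) (hmem _ hC _ hy) (hmem _ hC _ hw)]

theorem card_ncOn (A : Set ℕ) (a n : ℕ) : (ncOn A a (a + n)).card = (NCPA A n).card := by
  rw [← ncOn_zero_eq_NCPA]
  refine Finset.card_nbij' (Finset.image (Finset.image (· - a)))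
    (Finset.image (Finset.image (a + ·))) ?_ ?_ ?_ ?_
  · intro P hP
    exact mem_ncOn.2 (mem_ncOn.1 hP).unshift
  · intro P hP
    exact mem_ncOn.2 (mem_ncOn.1 hP).shift
  · intro P hP
    have h := mem_ncOn.1 hP
    rw [Finset.image_image]
    conv_rhs => rw [← Finset.image_id (s := P)]
    refine Finset.image_congr fun B hB => ?_
    simp only [Function.comp_apply, Finset.image_image, id_eq]
    conv_rhs => rw [← Finset.image_id (s := B)]
    refine Finset.image_congr fun x hx => ?_
    have := h.sub B hB x hx
    simp only [Function.comp_apply, id_eq]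
    lia
  · intro P hP
    rw [Finset.image_image]
    conv_rhs => rw [← Finset.image_id (s := P)]
    refine Finset.image_congr fun B hB => ?_
    simp [Finset.image_image, Function.comp_def]

theorem card_rooted_zero_right (A : Set ℕ) (n : ℕ) :
    (rooted A n 0).card = if n = 0 then 1 else 0 := by
  split_ifs with hn
  · subst hn
    rw [Finset.card_eq_one]
    refine ⟨(∅, ∅), ?_⟩
    ext ⟨B, P⟩
    simp only [mem_rooted, Finset.card_eq_zero, Finset.mem_singleton, Prod.mk.injEq]
    constructor
    · rintro ⟨h, h0⟩
      refine ⟨h0, Finset.eq_empty_of_forall_notMem fun C hC => ?_⟩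
      obtain ⟨x, hx⟩ := h.nonempty C hC
      have := h.sub C hC x hx
      lia
    · rintro ⟨rfl, rfl⟩
      refine ⟨⟨?_, ?_, ?_, ?_, ?_, ?_, ?_, ?_, ?_, ?_, ?_⟩, rfl⟩ <;> simp
      lia
  · rw [Finset.card_eq_zero]
    refine Finset.eq_empty_of_forall_notMem fun q hq => ?_
    obtain ⟨h, h0⟩ := mem_rooted.1 hq
    rw [Finset.card_eq_zero] at h0
    have := h.root
    simp_all

theorem card_NCPA_zero (A : Set ℕ) : (NCPA A 0).card = 1 := by
  rw [← ncOn_zero_eq_NCPA, Finset.card_eq_one]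
  refine ⟨∅, ?_⟩
  ext P
  rw [mem_ncOn, Finset.mem_singleton]
  constructor
  · intro h
    refine Finset.eq_empty_of_forall_notMem fun C hC => ?_
    obtain ⟨x, hx⟩ := h.nonempty C hC
    have := h.sub C hC x hx
    lia
  · rintro rfl
    constructor <;> simp
    lia

theorem IsRooted.insert_isNCOn {A : Set ℕ} {n : ℕ} {B : Finset ℕ} {P : Finset (Finset ℕ)}
    (hn : n ≠ 0) (h : IsRooted A n B P) (hB : B.card ∈ A) : IsNCOn A 0 n (insert B P) := by
  have hr : n ∈ B := h.root.resolve_left hn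
  constructor
  · simp only [Finset.forall_mem_insert]
    exact ⟨h.sub_root, h.sub⟩
  · simp only [Finset.forall_mem_insert]
    exact ⟨⟨n, hr⟩, h.nonempty⟩
  · simp only [Finset.forall_mem_insert]
    exact ⟨hB, h.card_mem⟩
  · simp only [Finset.exists_mem_insert]
    exact h.cover
  · simp only [Finset.forall_mem_insert]
    refine ⟨⟨by simp, fun C hC x hx hx' => (h.disj_root C hC x hx hx').elim⟩,
      fun C hC => ⟨fun x hx hx' => (h.disj_root C hC x hx' hx).elim, h.disj C hC⟩⟩
  · simp only [Finset.forall_mem_insert]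
    refine ⟨⟨?_, ?_⟩, ?_⟩
    · simp
    · intro C hC x y z w h1 h2 h3 hx hz hy hw
      exact (h.nc_root C hC x y z w h1 h2 h3 hx hz hy hw).elim
    · refine fun C hC => ⟨fun x y z w h1 h2 h3 hx hz hy hw => ?_, h.nc C hC⟩
      exact (h.nc_root' C hC x y z w h1 h2 h3 hx hz hy hw).elim

theorem IsNCOn.isRooted_erase {A : Set ℕ} {n : ℕ} {B : Finset ℕ} {P : Finset (Finset ℕ)}
    (h : IsNCOn A 0 n P) (hBP : B ∈ P) (hB : n ∈ B) : IsRooted A n B (P.erase B) := by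
  constructor
  · exact Or.inr hB
  · exact h.sub B hBP
  · exact fun C hC => h.sub C (Finset.mem_of_mem_erase hC)
  · exact fun C hC => h.nonempty C (Finset.mem_of_mem_erase hC)
  · exact fun C hC => h.card_mem C (Finset.mem_of_mem_erase hC)
  · intro x h0 hx
    obtain ⟨C, hC, hxC⟩ := h.cover x h0 hx
    by_cases hCB : C = B
    · exact Or.inl (hCB ▸ hxC)
    · exact Or.inr ⟨C, Finset.mem_erase.2 ⟨hCB, hC⟩, hxC⟩
  · intro C hC x hx hx'
    rw [Finset.mem_erase] at hC
    exact hC.1 (h.disj C hC.2 B hBP x hx' hx)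
  · exact fun C hC D hD => h.disj C (Finset.mem_of_mem_erase hC) D (Finset.mem_of_mem_erase hD)
  · intro C hC x y z w h1 h2 h3 hx hz hy hw
    rw [Finset.mem_erase] at hC
    exact hC.1 (h.nc B hBP C hC.2 x y z w h1 h2 h3 hx hz hy hw).symm
  · intro C hC x y z w h1 h2 h3 hx hz hy hw
    rw [Finset.mem_erase] at hC
    exact hC.1 (h.nc C hC.2 B hBP x y z w h1 h2 h3 hx hz hy hw)
  · exact fun C hC D hD => h.nc C (Finset.mem_of_mem_erase hC) D (Finset.mem_of_mem_erase hD)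

theorem card_NCPA_eq_sum_rooted (A : Set ℕ) {n : ℕ} (hn : n ≠ 0) :
    (NCPA A n).card = ∑ k ∈ (Finset.range (n + 1)).filter (· ∈ A), (rooted A n k).card := by
  rw [← ncOn_zero_eq_NCPA, ← Finset.card_sigma]
  symm
  refine Finset.card_bij (fun q _ => insert q.2.1 q.2.2) ?_ ?_ ?_
  · rintro ⟨k, B, P⟩ hq
    simp only [Finset.mem_sigma, Finset.mem_filter, mem_rooted] at hq
    obtain ⟨⟨-, hk⟩, h, rfl⟩ := hq
    exact mem_ncOn.2 (h.insert_isNCOn hn hk)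
  · rintro ⟨k, B, P⟩ hq ⟨k', B', P'⟩ hq' heq
    simp only [Finset.mem_sigma, Finset.mem_filter, mem_rooted] at hq hq' heq
    obtain ⟨⟨-, hk⟩, h, rfl⟩ := hq
    obtain ⟨⟨-, hk'⟩, h', rfl⟩ := hq'
    have hB := h.root.resolve_left hn
    have hB' := h'.root.resolve_left hn
    have hBP : B ∉ P := fun hm => h.disj_root B hm n hB hB
    have hBP' : B' ∉ P' := fun hm => h'.disj_root B' hm n hB' hB'
    have hBB : B = B' := by
      have : B ∈ insert B' P' := heq ▸ Finset.mem_insert_self B P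
      rw [Finset.mem_insert] at this
      exact this.resolve_right fun hm => h'.disj_root B hm n hB' hB
    subst hBB
    have hPP : P = P' := by
      rw [← Finset.erase_insert hBP, heq, Finset.erase_insert hBP']
    subst hPP
    rfl
  · intro P hP
    have h := mem_ncOn.1 hP
    obtain ⟨B, hBP, hB⟩ := h.cover n (by lia) le_rfl
    refine ⟨⟨B.card, B, P.erase B⟩, ?_, Finset.insert_erase hBP⟩
    simp only [Finset.mem_sigma, Finset.mem_filter, mem_rooted, Finset.mem_range]
    refine ⟨⟨?_, h.card_mem B hBP⟩, h.isRooted_erase hBP hB, trivial⟩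
    have : B ⊆ Finset.Icc 1 n := by
      intro x hx
      have := h.sub B hBP x hx
      rw [Finset.mem_Icc]
      lia
    have := Finset.card_le_card this
    rw [Nat.card_Icc] at this
    lia

theorem IsRooted.glue {A : Set ℕ} {m n : ℕ} {B : Finset ℕ} {Q R : Finset (Finset ℕ)}
    (h : IsRooted A m B Q) (hR : IsNCOn A m n R) (hmn : m ≤ n) :
    IsRooted A (n + 1) (insert (n + 1) B) (Q ∪ R) := by
  have hB := h.sub_root
  have hQ := h.sub
  have hRs := hR.sub
  constructor
  · simp
  · grind
  · grind
  · simp only [Finset.forall_mem_union]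
    exact ⟨h.nonempty, hR.nonempty⟩
  · simp only [Finset.forall_mem_union]
    exact ⟨h.card_mem, hR.card_mem⟩
  · intro x h0 hx
    have h1 := h.cover x h0
    have h2 := hR.cover x
    grind
  · have := h.disj_root
    grind
  · simp only [Finset.forall_mem_union]
    refine ⟨fun C hC => ⟨h.disj C hC, ?_⟩, fun C hC => ⟨?_, hR.disj C hC⟩⟩
    · grind
    · grind
  · simp only [Finset.forall_mem_union, Finset.mem_insert]
    refine ⟨fun C hC x y z w h1 h2 h3 hx hz hy hw => ?_,
      fun C hC x y z w h1 h2 h3 hx hz hy hw => ?_⟩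
    · have := h.nc_root C hC x y z w h1 h2 h3
      grind
    · grind
  · simp only [Finset.forall_mem_union, Finset.mem_insert]
    refine ⟨fun C hC x y z w h1 h2 h3 hx hz hy hw => ?_,
      fun C hC x y z w h1 h2 h3 hx hz hy hw => ?_⟩
    · have hy' : y ∈ B := by grind
      rcases hw with rfl | hw
      · have hm : m ∈ B := h.root.resolve_left (by grind)
        have hzm : z ≠ m := fun e => h.disj_root C hC m hm (e ▸ hz)
        exact h.nc_root' C hC x y z m h1 h2 (by grind) hx hz hy' hm
      · exact h.nc_root' C hC x y z w h1 h2 h3 hx hz hy' hw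
    · grind
  · simp only [Finset.forall_mem_union]
    refine ⟨fun C hC => ⟨h.nc C hC, ?_⟩, fun C hC => ⟨?_, hR.nc C hC⟩⟩
    · grind
    · grind

theorem IsRooted.le_or_lt {A : Set ℕ} {n m : ℕ} {B : Finset ℕ} {P : Finset (Finset ℕ)}
    (h : IsRooted A (n + 1) B P) (hm : m = 0 ∨ m ∈ B) {C : Finset ℕ} (hC : C ∈ P) :
    (∀ x ∈ C, x ≤ m) ∨ (∀ x ∈ C, m < x) := by
  by_contra! hcon
  obtain ⟨⟨w, hw, hmw⟩, ⟨x, hx, hxm⟩⟩ := hcon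
  have hn : n + 1 ∈ B := by simpa using h.root
  have hw' := h.sub C hC w hw
  have hx' := h.sub C hC x hx
  have hm : m ∈ B := hm.resolve_left (by lia)
  have h1 : x ≠ m := fun e => h.disj_root C hC m hm (e ▸ hx)
  have h2 : w ≠ n + 1 := fun e => h.disj_root C hC (n + 1) hn (e ▸ hw)
  exact h.nc_root' C hC x m w (n + 1) (by lia) (by lia) (by lia) hx hw hm hn

theorem IsRooted.cut {A : Set ℕ} {n m : ℕ} {B : Finset ℕ} {P : Finset (Finset ℕ)}
    (h : IsRooted A (n + 1) B P) (hm : m = 0 ∨ m ∈ B) (hmn : m ≤ n)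
    (hBm : ∀ x ∈ B, x ≠ n + 1 → x ≤ m) :
    IsRooted A m (B.erase (n + 1)) (P.filter fun C => ∀ x ∈ C, x ≤ m) ∧
      IsNCOn A m n (P.filter fun C => ∀ x ∈ C, m < x) := by
  have hn : n + 1 ∈ B := by simpa using h.root
  have hsub := h.sub
  have hsubr := h.sub_root
  have hcov := h.cover
  have hlt : ∀ C ∈ P, _ := fun C hC => h.le_or_lt hm hC
  have hdr := h.disj_root
  constructor
  · constructor
    · grind
    · grind
    · grind
    · exact fun C hC => h.nonempty C (Finset.mem_of_mem_filter C hC)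
    · exact fun C hC => h.card_mem C (Finset.mem_of_mem_filter C hC)
    · grind
    · grind
    · exact fun C hC D hD => h.disj C (Finset.mem_of_mem_filter C hC) D
        (Finset.mem_of_mem_filter D hD)
    · exact fun C hC x y z w h1 h2 h3 hx hz => h.nc_root C (Finset.mem_of_mem_filter C hC)
        x y z w h1 h2 h3 (Finset.mem_of_mem_erase hx) (Finset.mem_of_mem_erase hz)
    · exact fun C hC x y z w h1 h2 h3 hx hz hy hw => h.nc_root' C (Finset.mem_of_mem_filter C hC)
        x y z w h1 h2 h3 hx hz (Finset.mem_of_mem_erase hy) (Finset.mem_of_mem_erase hw)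
    · exact fun C hC D hD => h.nc C (Finset.mem_of_mem_filter C hC) D
        (Finset.mem_of_mem_filter D hD)
  · constructor
    · grind
    · exact fun C hC => h.nonempty C (Finset.mem_of_mem_filter C hC)
    · exact fun C hC => h.card_mem C (Finset.mem_of_mem_filter C hC)
    · intro x h1 h2
      obtain ⟨C, hC, hxC⟩ := (hcov x (by lia) (by lia)).resolve_left
        fun hx => by have := hBm x hx (by lia); lia
      refine ⟨C, Finset.mem_filter.2 ⟨hC, (hlt C hC).resolve_left fun hle => ?_⟩, hxC⟩
      have := hle x hxC
      lia
    · exact fun C hC D hD => h.disj C (Finset.mem_of_mem_filter C hC) D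
        (Finset.mem_of_mem_filter D hD)
    · exact fun C hC D hD => h.nc C (Finset.mem_of_mem_filter C hC) D
        (Finset.mem_of_mem_filter D hD)

theorem IsRooted.sup_id {A : Set ℕ} {m : ℕ} {B : Finset ℕ} {P : Finset (Finset ℕ)}
    (h : IsRooted A m B P) : B.sup id = m := by
  refine le_antisymm (Finset.sup_le fun x hx => (h.sub_root x hx).2) ?_
  rcases h.root with rfl | hm
  · exact Nat.zero_le _
  · exact Finset.le_sup (f := id) hm

theorem sup_id_eq_zero_or_mem (B : Finset ℕ) : B.sup id = 0 ∨ B.sup id ∈ B := by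
  rcases B.eq_empty_or_nonempty with rfl | hB
  · simp
  · obtain ⟨x, hx, h⟩ := Finset.exists_mem_eq_sup B hB id
    exact Or.inr (h ▸ hx)

theorem card_rooted_succ_succ (A : Set ℕ) (n k : ℕ) :
    (rooted A (n + 1) (k + 1)).card =
      ∑ p ∈ Finset.HasAntidiagonal.antidiagonal n, (rooted A p.1 k).card * (NCPA A p.2).card := by
  have hcard : ∀ p ∈ Finset.HasAntidiagonal.antidiagonal n, (rooted A p.1 k).card * (NCPA A p.2).card =
      (rooted A p.1 k ×ˢ ncOn A p.1 n).card := by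
    rintro ⟨a, b⟩ hp
    rw [Finset.HasAntidiagonal.mem_antidiagonal] at hp
    simp only at hp
    rw [Finset.card_product, ← hp, card_ncOn]
  rw [Finset.sum_congr rfl hcard, Finset.Nat.sum_antidiagonal_eq_sum_range_succ_mk,
    ← Finset.card_sigma]
  symm
  refine Finset.card_bij' (fun q _ => (insert (n + 1) q.2.1.1, q.2.1.2 ∪ q.2.2))
    (fun q _ => ⟨(q.1.erase (n + 1)).sup id,
      ((q.1.erase (n + 1), q.2.filter fun C => ∀ x ∈ C, x ≤ (q.1.erase (n + 1)).sup id),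
        q.2.filter fun C => ∀ x ∈ C, (q.1.erase (n + 1)).sup id < x)⟩) ?_ ?_ ?_ ?_
  · rintro ⟨m, ⟨B, Q⟩, R⟩ hq
    simp only [Finset.mem_sigma, Finset.mem_range, Finset.mem_product, mem_rooted, mem_ncOn] at hq
    obtain ⟨hm, ⟨h, rfl⟩, hR⟩ := hq
    refine mem_rooted.2 ⟨h.glue hR (by lia), ?_⟩
    refine Finset.card_insert_of_notMem fun hmem => ?_
    have := h.sub_root _ hmem
    lia
  · rintro ⟨B, P⟩ hq
    obtain ⟨h, hc⟩ := mem_rooted.1 hq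
    simp only at h hc
    have hn : n + 1 ∈ B := by simpa using h.root
    have hle : (B.erase (n + 1)).sup id ≤ n := by
      refine Finset.sup_le fun x hx => ?_
      rw [Finset.mem_erase] at hx
      have := h.sub_root x hx.2
      simp only [id_eq]
      lia
    have := h.cut ((sup_id_eq_zero_or_mem (B.erase (n + 1))).imp_right Finset.mem_of_mem_erase)
      hle (fun x hx hne => Finset.le_sup (f := id) (Finset.mem_erase.2 ⟨hne, hx⟩))
    simp only [Finset.mem_sigma, Finset.mem_range, Finset.mem_product, mem_rooted, mem_ncOn]
    refine ⟨by lia, ⟨this.1, ?_⟩, this.2⟩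
    rw [Finset.card_erase_of_mem hn]
    lia
  · rintro ⟨m, ⟨B, Q⟩, R⟩ hq
    simp only [Finset.mem_sigma, Finset.mem_range, Finset.mem_product, mem_rooted, mem_ncOn] at hq
    obtain ⟨hm, ⟨h, rfl⟩, hR⟩ := hq
    have hB : (insert (n + 1) B).erase (n + 1) = B := by
      refine Finset.erase_insert fun hmem => ?_
      have := h.sub_root _ hmem
      lia
    have h1 : (Q ∪ R).filter (fun C => ∀ x ∈ C, x ≤ m) = Q := by
      ext C
      have h2 := h.sub C
      have h3 := hR.sub C
      have h4 := hR.nonempty C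
      simp only [Finset.mem_filter, Finset.mem_union]
      constructor
      · rintro ⟨hC | hC, hC'⟩
        · exact hC
        · obtain ⟨x, hx⟩ := h4 hC
          have := h3 hC x hx
          have := hC' x hx
          lia
      · exact fun hC => ⟨Or.inl hC, fun x hx => (h2 hC x hx).2⟩
    have h2 : (Q ∪ R).filter (fun C => ∀ x ∈ C, m < x) = R := by
      ext C
      have h2 := h.sub C
      have h3 := hR.sub C
      have h4 := h.nonempty C
      simp only [Finset.mem_filter, Finset.mem_union]
      constructor
      · rintro ⟨hC | hC, hC'⟩
        · obtain ⟨x, hx⟩ := h4 hC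
          have := h2 hC x hx
          have := hC' x hx
          lia
        · exact hC
      · exact fun hC => ⟨Or.inr hC, fun x hx => (h3 hC x hx).1⟩
    simp only [hB, h.sup_id, h1, h2]
  · rintro ⟨B, P⟩ hq
    obtain ⟨h, hc⟩ := mem_rooted.1 hq
    simp only at h hc
    have hn : n + 1 ∈ B := by simpa using h.root
    simp only [Finset.insert_erase hn, Prod.mk.injEq, true_and]
    rw [← Finset.filter_or, Finset.filter_eq_self]
    intro C hC
    exact h.le_or_lt
      ((sup_id_eq_zero_or_mem (B.erase (n + 1))).imp_right Finset.mem_of_mem_erase) hC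

theorem card_rooted_zero_succ (A : Set ℕ) (k : ℕ) : (rooted A 0 (k + 1)).card = 0 := by
  rw [Finset.card_eq_zero]
  refine Finset.eq_empty_of_forall_notMem fun q hq => ?_
  obtain ⟨h, h0⟩ := mem_rooted.1 hq
  obtain ⟨x, hx⟩ := Finset.card_pos.1 (by rw [h0]; exact Nat.succ_pos k)
  have := h.sub_root x hx
  lia

open PowerSeries in
/-- **Lagrange inversion** for a power series `F` satisfying `F(z) = W(z F(z))`. -/
theorem lagrange_coeff_pow {F W : PowerSeries ℝ}
    (hF : ∀ n, coeff n F = ∑ j ∈ Finset.range (n + 1), coeff j W * coeff n ((X * F) ^ j))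
    (n k : ℕ) : ((n : ℝ) + k) * coeff n (F ^ k) = k * coeff n (W ^ (n + k)) := by
  have hX : ∀ n j k, coeff n ((X * F) ^ j * F ^ k) =
      if j ≤ n then coeff (n - j) (F ^ (j + k)) else 0 := by
    intro n j k
    rw [mul_pow, mul_assoc, ← pow_add, coeff_X_pow_mul']
  have hrec : ∀ n k, coeff n (F ^ (k + 1)) =
      ∑ j ∈ Finset.range (n + 1), coeff j W * coeff (n - j) (F ^ (j + k)) := by
    intro n k
    have hext : ∀ p ∈ Finset.HasAntidiagonal.antidiagonal n, coeff p.1 F * coeff p.2 (F ^ k) =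
        ∑ j ∈ Finset.range (n + 1),
          coeff j W * (coeff p.1 ((X * F) ^ j) * coeff p.2 (F ^ k)) := by
      intro p hp
      rw [Finset.HasAntidiagonal.mem_antidiagonal] at hp
      rw [hF, Finset.sum_mul]
      simp only [mul_assoc]
      refine Finset.sum_subset (Finset.range_mono (by lia)) fun j _ hj => ?_
      rw [Finset.mem_range, not_lt] at hj
      have := hX p.1 j 0
      rw [pow_zero, mul_one, if_neg (by lia)] at this
      rw [this, zero_mul, mul_zero]
    rw [pow_succ', coeff_mul, Finset.sum_congr rfl hext, Finset.sum_comm]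
    refine Finset.sum_congr rfl fun j hj => ?_
    rw [← Finset.mul_sum, ← coeff_mul, hX, if_pos (by rw [Finset.mem_range] at hj; lia)]
  have hder : ∀ n M : ℕ, (n : ℝ) * coeff n (W ^ (M + 1)) =
      (M + 1) * ∑ j ∈ Finset.range (n + 1), (j * coeff j W) * coeff (n - j) (W ^ M) := by
    have hXd : ∀ (G : PowerSeries ℝ) (n : ℕ), coeff n (X * d⁄dX ℝ G) = n * coeff n G := by
      intro G n
      cases n with
      | zero => simp
      | succ n => rw [coeff_succ_X_mul, coeff_derivative, mul_comm]; push_cast; ring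
    intro n M
    have h1 : X * d⁄dX ℝ (W ^ (M + 1)) = C ((M : ℝ) + 1) * ((X * d⁄dX ℝ W) * W ^ M) := by
      rw [Derivation.leibniz_pow]
      simp only [add_tsub_cancel_right, smul_eq_mul, nsmul_eq_mul, map_add, map_natCast, map_one]
      push_cast
      ring
    rw [← hXd, h1, coeff_C_mul, coeff_mul, Finset.Nat.sum_antidiagonal_eq_sum_range_succ_mk]
    simp only [hXd]
  induction n using Nat.strong_induction_on generalizing k with
  | _ n ihn =>
    induction k with
    | zero =>
      rcases Nat.eq_zero_or_pos n with rfl | hn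
      · simp
      · simp [coeff_one, hn.ne']
    | succ k ihk =>
      rcases Nat.eq_zero_or_pos (n + k) with h0 | h0
      · obtain ⟨rfl, rfl⟩ : n = 0 ∧ k = 0 := by lia
        have := hF 0
        simpa using this
      have hpos : (0 : ℝ) < n + k := by exact_mod_cast h0
      have hterm : ∀ j ∈ Finset.range (n + 1),
          ((n : ℝ) + k) * (coeff j W * coeff (n - j) (F ^ (j + k))) =
            k * (coeff j W * coeff (n - j) (W ^ (n + k))) +
              (j * coeff j W) * coeff (n - j) (W ^ (n + k)) := by
        intro j hj
        rw [Finset.mem_range] at hj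
        have key : ((n : ℝ) + k) * coeff (n - j) (F ^ (j + k)) =
            (j + k) * coeff (n - j) (W ^ (n + k)) := by
          rcases Nat.eq_zero_or_pos j with rfl | hj0
          · simpa using ihk
          · have := ihn (n - j) (by lia) (j + k)
            rw [show n - j + (j + k) = n + k by lia, Nat.cast_sub (by lia)] at this
            push_cast at this
            linarith
        linear_combination coeff j W * key
      have hs : ((n : ℝ) + k) * coeff n (F ^ (k + 1)) = k * coeff n (W ^ (n + k + 1)) +
          ∑ j ∈ Finset.range (n + 1), (j * coeff j W) * coeff (n - j) (W ^ (n + k)) := by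
        rw [hrec, Finset.mul_sum, Finset.sum_congr rfl hterm, Finset.sum_add_distrib,
          ← Finset.mul_sum, pow_succ', coeff_mul,
          Finset.Nat.sum_antidiagonal_eq_sum_range_succ_mk]
      have hd := hder n (n + k)
      refine mul_left_cancel₀ hpos.ne' ?_
      rw [← add_assoc n k 1]
      push_cast at hd ⊢
      linear_combination ((n : ℝ) + k + 1) * hs - hd

open PowerSeries in
theorem card_rooted_eq_coeff (A : Set ℕ) (n k : ℕ) : ((rooted A n k).card : ℝ) =
    coeff n ((X * PowerSeries.mk fun m => ((NCPA A m).card : ℝ)) ^ k) := by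
  induction k generalizing n with
  | zero => rw [card_rooted_zero_right, pow_zero, coeff_one]; push_cast; rfl
  | succ k ih =>
    cases n with
    | zero => rw [card_rooted_zero_succ]; simp
    | succ n =>
      rw [card_rooted_succ_succ, pow_succ, mul_left_comm, coeff_succ_X_mul, coeff_mul]
      push_cast
      exact Finset.sum_congr rfl fun p _ => by rw [ih, coeff_mk]

open PowerSeries in
theorem succ_mul_card_NCPA {A : Set ℕ} (h0 : 0 ∉ A) (n : ℕ) :
    ((n : ℝ) + 1) * (NCPA A n).card =
      coeff n ((PowerSeries.mk fun k => if k = 0 ∨ k ∈ A then (1 : ℝ) else 0) ^ (n + 1)) := by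
  have h := lagrange_coeff_pow (F := PowerSeries.mk fun m => ((NCPA A m).card : ℝ))
    (W := PowerSeries.mk fun k => if k = 0 ∨ k ∈ A then (1 : ℝ) else 0) ?_ n 1
  · simpa using h
  intro n
  simp only [← card_rooted_eq_coeff, coeff_mk]
  rcases Nat.eq_zero_or_pos n with rfl | hn
  · simp [card_NCPA_zero, card_rooted_zero_right]
  · rw [card_NCPA_eq_sum_rooted A hn.ne', Finset.sum_filter]
    push_cast
    refine Finset.sum_congr rfl fun k _ => ?_
    rcases Nat.eq_zero_or_pos k with rfl | hk
    · simp [h0, card_rooted_zero_right, hn.ne']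
    · simp [hk.ne']

open PowerSeries in
theorem summable_coeff_pow_mul_pow {p : ℕ → ℝ} {z : ℂ}
    (h : Summable fun k => ‖(p k : ℂ) * z ^ k‖) (N : ℕ) :
    Summable (fun m => ‖((coeff m (PowerSeries.mk p ^ N) : ℝ) : ℂ) * z ^ m‖) ∧
      ∑' m, ((coeff m (PowerSeries.mk p ^ N) : ℝ) : ℂ) * z ^ m =
        (∑' k, (p k : ℂ) * z ^ k) ^ N := by
  induction N with
  | zero =>
    have h0 : ∀ m, m ∉ ({0} : Finset ℕ) →
        ((coeff m (PowerSeries.mk p ^ 0) : ℝ) : ℂ) * z ^ m = 0 := by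
      intro m hm
      rw [Finset.mem_singleton] at hm
      simp [coeff_one, hm]
    constructor
    · refine summable_of_ne_finset_zero (s := {0}) ?_
      intro m hm
      rw [h0 m hm, norm_zero]
    · rw [tsum_eq_sum h0]
      simp
  | succ N ih =>
    have hc : ∀ m, ((coeff m (PowerSeries.mk p ^ (N + 1)) : ℝ) : ℂ) * z ^ m =
        ∑ q ∈ Finset.HasAntidiagonal.antidiagonal m,
          (((coeff q.1 (PowerSeries.mk p ^ N) : ℝ) : ℂ) * z ^ q.1) * ((p q.2 : ℂ) * z ^ q.2) := by
      intro m
      rw [pow_succ, coeff_mul]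
      push_cast
      rw [Finset.sum_mul]
      refine Finset.sum_congr rfl fun q hq => ?_
      rw [Finset.HasAntidiagonal.mem_antidiagonal] at hq
      rw [← hq, pow_add, coeff_mk]
      ring
    have hs := summable_norm_sum_mul_antidiagonal_of_summable_norm
      (f := fun m => ((coeff m (PowerSeries.mk p ^ N) : ℝ) : ℂ) * z ^ m)
      (g := fun k => (p k : ℂ) * z ^ k) ih.1 h
    have ht := tsum_mul_tsum_eq_tsum_sum_antidiagonal_of_summable_norm
      (f := fun m => ((coeff m (PowerSeries.mk p ^ N) : ℝ) : ℂ) * z ^ m)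
      (g := fun k => (p k : ℂ) * z ^ k) ih.1 h
    constructor
    · exact hs.congr fun m => congrArg _ (hc m).symm
    · rw [tsum_congr hc, pow_succ, ← ih.2]
      exact ht.symm

open PowerSeries in
theorem dvd_of_coeff_pow_ne_zero {p : ℕ → ℝ} {d : ℕ} (hd : ∀ k, p k ≠ 0 → d ∣ k) (N m : ℕ)
    (hm : coeff m (PowerSeries.mk p ^ N) ≠ 0) : d ∣ m := by
  induction N generalizing m with
  | zero =>
    rw [pow_zero, coeff_one] at hm
    have : m = 0 := by
      by_contra h
      simp [h] at hm
    simp [this]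
  | succ N ih =>
    rw [pow_succ, coeff_mul] at hm
    obtain ⟨q, hq, hne⟩ := Finset.exists_ne_zero_of_sum_ne_zero hm
    rw [Finset.HasAntidiagonal.mem_antidiagonal] at hq
    rw [coeff_mk] at hne
    rw [← hq]
    exact dvd_add (ih _ (left_ne_zero_of_mul hne)) (hd _ (right_ne_zero_of_mul hne))

/-- The characteristic function of the weights `p` on `ℕ`. -/
noncomputable def latticeChar (p : ℕ → ℝ) (t : ℝ) : ℂ :=
  ∑' k, (p k : ℂ) * Complex.exp (t * Complex.I) ^ k

theorem integral_exp_lattice {d : ℕ} (hd : 0 < d) (j : ℤ) (hj : (d : ℤ) ∣ j) :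
    ∫ t in (-(Real.pi / d))..(Real.pi / d), Complex.exp (j * Complex.I * t) =
      if j = 0 then ((2 * Real.pi / d : ℝ) : ℂ) else 0 := by
  have hd' : (d : ℂ) ≠ 0 := by exact_mod_cast hd.ne'
  split_ifs with h
  · subst h
    simp only [Int.cast_zero, zero_mul, Complex.exp_zero, intervalIntegral.integral_const,
      Complex.real_smul, mul_one]
    push_cast
    ring
  · have hc : (j : ℂ) * Complex.I ≠ 0 :=
      mul_ne_zero (by exact_mod_cast h) Complex.I_ne_zero
    rw [integral_exp_mul_complex hc, div_eq_zero_iff]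
    left
    rw [sub_eq_zero, Complex.exp_eq_exp_iff_exists_int]
    obtain ⟨i, rfl⟩ := hj
    refine ⟨i, ?_⟩
    push_cast
    field_simp
    ring

open PowerSeries in
theorem integral_latticeChar_pow {p : ℕ → ℝ} {d : ℕ} (hp : Summable fun k => ‖p k‖) (hd : 0 < d)
    (hdvd : ∀ k, p k ≠ 0 → d ∣ k) (N n : ℕ) (hn : d ∣ n) :
    ∫ t in (-(Real.pi / d))..(Real.pi / d),
        latticeChar p t ^ N * Complex.exp (-(n * t * Complex.I)) =
      ((2 * Real.pi / d * coeff n (PowerSeries.mk p ^ N) : ℝ) : ℂ) := by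
  have hz : ∀ t : ℝ, ‖Complex.exp (t * Complex.I)‖ = 1 := Complex.norm_exp_ofReal_mul_I
  have hsum : ∀ t : ℝ, Summable fun k => ‖(p k : ℂ) * Complex.exp (t * Complex.I) ^ k‖ := by
    intro t
    simpa [hz] using hp
  set q : ℕ → ℝ := fun m => coeff m (PowerSeries.mk p ^ N) with hq
  have hqs : Summable fun m => ‖q m‖ := by
    simpa [hz] using (summable_coeff_pow_mul_pow (hsum 0) N).1
  have key : HasSum (fun m => ∫ t in (-(Real.pi / d))..(Real.pi / d),
        ((q m : ℂ) * Complex.exp (t * Complex.I) ^ m) * Complex.exp (-(n * t * Complex.I)))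
      (∫ t in (-(Real.pi / d))..(Real.pi / d),
        latticeChar p t ^ N * Complex.exp (-(n * t * Complex.I))) := by
    refine intervalIntegral.hasSum_integral_of_dominated_convergence (fun m _ => ‖q m‖)
      ?_ ?_ ?_ ?_ ?_
    · intro m
      exact (Continuous.aestronglyMeasurable (by fun_prop))
    · refine fun m => Filter.Eventually.of_forall fun t _ => le_of_eq ?_
      rw [norm_mul, norm_mul, norm_pow, hz, one_pow, mul_one, Complex.norm_real,
        show -((n : ℂ) * t * Complex.I) = ((-(n * t) : ℝ) : ℂ) * Complex.I by push_cast; ring,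
        hz, mul_one]
    · exact Filter.Eventually.of_forall fun t _ => hqs
    · exact intervalIntegrable_const
    · refine Filter.Eventually.of_forall fun t _ => HasSum.mul_right _ ?_
      have := summable_coeff_pow_mul_pow (hsum t) N
      rw [latticeChar, ← this.2]
      exact this.1.of_norm.hasSum
  have hterm : ∀ m, ∫ t in (-(Real.pi / d))..(Real.pi / d),
        ((q m : ℂ) * Complex.exp (t * Complex.I) ^ m) * Complex.exp (-(n * t * Complex.I)) =
      if m = n then ((2 * Real.pi / d * q n : ℝ) : ℂ) else 0 := by
    intro m
    have h1 : ∀ t : ℝ,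
        ((q m : ℂ) * Complex.exp (t * Complex.I) ^ m) * Complex.exp (-(n * t * Complex.I)) =
          (q m : ℂ) * Complex.exp (((m : ℤ) - (n : ℤ) : ℤ) * Complex.I * t) := by
      intro t
      rw [← Complex.exp_nat_mul, mul_assoc, ← Complex.exp_add]
      push_cast
      ring_nf
    simp only [h1]
    rw [intervalIntegral.integral_const_mul]
    by_cases hqm : q m = 0
    · rw [hqm]
      split_ifs with h
      · subst h; simp [hqm]
      · simp
    · rw [integral_exp_lattice hd]
      · by_cases h : m = n
        · subst h
          simp only [sub_self, if_true]
          push_cast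
          ring
        · rw [if_neg h, if_neg (by lia), mul_zero]
      · exact dvd_sub (Int.natCast_dvd_natCast.2 (dvd_of_coeff_pow_ne_zero hdvd N m hqm))
          (Int.natCast_dvd_natCast.2 hn)
  simp only [hterm] at key
  exact key.unique (hasSum_ite_eq n _)

theorem norm_add_mul_lt {a b : ℝ} (ha : 0 < a) (hb : 0 < b) {z : ℂ} (hz : ‖z‖ = 1) (hz1 : z ≠ 1) :
    ‖(a : ℂ) + b * z‖ < a + b := by
  have h1 : z.re * z.re + z.im * z.im = 1 := by
    rw [← Complex.normSq_apply, Complex.normSq_eq_norm_sq, hz, one_pow]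
  have hre : z.re < 1 := by
    refine lt_of_le_of_ne (hz ▸ Complex.re_le_norm z) fun hre => hz1 ?_
    have him : z.im = 0 := by
      rw [hre] at h1
      exact mul_self_eq_zero.1 (by linarith)
    exact Complex.ext hre him
  refine lt_of_pow_lt_pow_left₀ 2 (by positivity) ?_
  rw [← Complex.normSq_eq_norm_sq, Complex.normSq_apply]
  simp only [Complex.add_re, Complex.ofReal_re, Complex.mul_re, Complex.ofReal_im, zero_mul,
    sub_zero, Complex.add_im, Complex.mul_im, zero_add, add_zero]
  have hab : a * b * z.re < a * b := mul_lt_of_lt_one_right (mul_pos ha hb) hre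
  linear_combination 2 * hab + b ^ 2 * h1

theorem norm_latticeChar_lt_one {p : ℕ → ℝ} (hp : ∀ k, 0 ≤ p k) (hp0 : 0 < p 0) (hsum : HasSum p 1)
    {d : ℕ} (hd : 0 < d) (hgcd : ∀ m : ℕ, (∀ k, p k ≠ 0 → m ∣ k) → m ∣ d) {t : ℝ} (ht : t ≠ 0)
    (htd : |t| ≤ Real.pi / d) : ‖latticeChar p t‖ < 1 := by
  set z := Complex.exp (t * Complex.I) with hz
  have hz1 : ‖z‖ = 1 := Complex.norm_exp_ofReal_mul_I t
  have hex : ∃ k, p k ≠ 0 ∧ z ^ k ≠ 1 := by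
    by_contra! hcon
    have hdvd : orderOf z ∣ d := hgcd _ fun k hk => orderOf_dvd_of_pow_eq_one (hcon k hk)
    have hzd : z ^ d = 1 := orderOf_dvd_iff_pow_eq_one.1 hdvd
    rw [hz, ← Complex.exp_nat_mul, Complex.exp_eq_one_iff] at hzd
    obtain ⟨j, hj⟩ := hzd
    have hj' : (d : ℝ) * t = 2 * Real.pi * j := by
      have h2 : ((d : ℂ) * t) * Complex.I = ((2 * Real.pi * j : ℝ) : ℂ) * Complex.I := by
        push_cast
        linear_combination hj
      have := mul_right_cancel₀ Complex.I_ne_zero h2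
      exact_mod_cast this
    have hdR : (0 : ℝ) < d := by exact_mod_cast hd
    have habs : 2 * Real.pi * |(j : ℝ)| ≤ Real.pi := by
      calc 2 * Real.pi * |(j : ℝ)| = |(d : ℝ) * t| := by
            rw [hj', abs_mul, abs_of_pos Real.two_pi_pos]
        _ = d * |t| := by rw [abs_mul, abs_of_pos hdR]
        _ ≤ d * (Real.pi / d) := by gcongr
        _ = Real.pi := by field_simp
    have hj0 : j = 0 := by
      by_contra h
      have : (1 : ℝ) ≤ |(j : ℝ)| := by exact_mod_cast Int.one_le_abs h
      nlinarith [Real.pi_pos]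
    rw [hj0] at hj'
    simp only [Int.cast_zero, mul_zero, mul_eq_zero] at hj'
    exact hj'.elim hdR.ne' ht
  obtain ⟨k, hk, hzk⟩ := hex
  have hk0 : 0 ≠ k := by rintro rfl; simp at hzk
  have hn : ∀ k, ‖(p k : ℂ) * z ^ k‖ = p k := by
    intro k
    rw [norm_mul, norm_pow, hz1, one_pow, mul_one, Complex.norm_real, Real.norm_of_nonneg (hp k)]
  have hs : Summable fun k => ‖(p k : ℂ) * z ^ k‖ := by
    simp only [hn]
    exact hsum.summable
  have h1 := hs.of_norm.sum_add_tsum_compl (s := {0, k})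
  have h2 := hsum.summable.sum_add_tsum_compl (s := {0, k})
  rw [hsum.tsum_eq, Finset.sum_pair hk0] at h2
  rw [Finset.sum_pair hk0] at h1
  rw [latticeChar, ← h1]
  have h3 : ‖∑' x : ↑((({0, k} : Finset ℕ) : Set ℕ)ᶜ), (p x : ℂ) * z ^ (x : ℕ)‖ ≤
      ∑' x : ↑((({0, k} : Finset ℕ) : Set ℕ)ᶜ), p x := by
    refine (norm_tsum_le_tsum_norm (hs.subtype _)).trans_eq ?_
    simp only [hn]
  have h4 := norm_add_mul_lt hp0 (lt_of_le_of_ne (hp k) hk.symm) (z := z ^ k)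
    (by rw [norm_pow, hz1, one_pow]) hzk
  refine (norm_add_le _ _).trans_lt ?_
  rw [pow_zero, mul_one]
  linarith

theorem continuous_latticeChar {p : ℕ → ℝ} (hp : Summable fun k => ‖p k‖) :
    Continuous (latticeChar p) := by
  refine continuous_tsum (fun k => by fun_prop) hp fun k t => ?_
  rw [norm_mul, norm_pow, Complex.norm_exp_ofReal_mul_I, one_pow, mul_one, Complex.norm_real]

theorem norm_exp_mul_I_sub_taylor_le (x : ℝ) :
    ‖Complex.exp (x * Complex.I) - (1 + x * Complex.I - x ^ 2 / 2)‖ ≤ 4 * |x| ^ 3 := by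
  rcases le_total |x| 1 with hx | hx
  · have h := Complex.exp_bound (x := x * Complex.I) (by simpa using hx) (n := 3) (by norm_num)
    have h2 : ∑ m ∈ Finset.range 3, ((x : ℂ) * Complex.I) ^ m / (m.factorial : ℂ) =
        1 + x * Complex.I - x ^ 2 / 2 := by
      simp [Finset.sum_range_succ, mul_pow, Nat.factorial]
      ring
    rw [h2] at h
    refine h.trans ?_
    have h3 : ‖(x : ℂ) * Complex.I‖ = |x| := by simp
    rw [h3, mul_comm]
    gcongr
    norm_num [Nat.factorial]
  · have h1 : ‖Complex.exp (x * Complex.I) - (1 + x * Complex.I - x ^ 2 / 2)‖ ≤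
        1 + (1 + |x| + |x| ^ 2 / 2) := by
      refine (norm_sub_le _ _).trans ?_
      rw [Complex.norm_exp_ofReal_mul_I]
      gcongr
      refine (norm_sub_le _ _).trans ?_
      gcongr
      · refine (norm_add_le _ _).trans ?_
        simp
      · simp
    have h2 : |x| ≤ |x| ^ 3 := le_self_pow₀ hx (by norm_num)
    have h3 : |x| ^ 2 ≤ |x| ^ 3 := pow_le_pow_right₀ hx (by norm_num)
    linarith

theorem norm_latticeChar_sub_taylor_le {p : ℕ → ℝ} {v : ℝ} (hp : ∀ k, 0 ≤ p k) (h0 : HasSum p 1)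
    (h1 : HasSum (fun k : ℕ => (k : ℝ) * p k) 1) (h2 : HasSum (fun k : ℕ => ((k : ℝ) - 1) ^ 2 * p k) v)
    (h3 : Summable fun k : ℕ => (k : ℝ) ^ 3 * p k) :
    ∃ K : ℝ, 0 < K ∧ ∀ t : ℝ,
      ‖latticeChar p t * Complex.exp (-(t * Complex.I)) - (1 - v * t ^ 2 / 2)‖ ≤ K * |t| ^ 3 := by
  have hbd : ∀ k : ℕ, |(k : ℝ) - 1| ^ 3 * p k ≤ (k : ℝ) ^ 3 * p k + p k := by
    intro k
    have : |(k : ℝ) - 1| ^ 3 ≤ (k : ℝ) ^ 3 + 1 := by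
      rcases Nat.eq_zero_or_pos k with rfl | hk
      · simp
      · have hk1 : (1 : ℝ) ≤ k := by exact_mod_cast hk
        rw [abs_of_nonneg (by linarith)]
        have : ((k : ℝ) - 1) ^ 3 ≤ (k : ℝ) ^ 3 := pow_le_pow_left₀ (by linarith) (by linarith) 3
        linarith
    nlinarith [mul_le_mul_of_nonneg_right this (hp k)]
  have hS : Summable fun k : ℕ => |(k : ℝ) - 1| ^ 3 * p k :=
    Summable.of_nonneg_of_le (fun k => mul_nonneg (by positivity) (hp k)) hbd (h3.add h0.summable)
  refine ⟨4 * (∑' k : ℕ, |(k : ℝ) - 1| ^ 3 * p k) + 1, ?_, fun t => ?_⟩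
  · have : 0 ≤ ∑' k : ℕ, |(k : ℝ) - 1| ^ 3 * p k :=
      tsum_nonneg fun k => mul_nonneg (by positivity) (hp k)
    linarith
  have hchar : HasSum (fun k => (p k : ℂ) * Complex.exp ((((k : ℝ) - 1) * t : ℝ) * Complex.I))
      (latticeChar p t * Complex.exp (-(t * Complex.I))) := by
    have hs : Summable fun k => (p k : ℂ) * Complex.exp (t * Complex.I) ^ k := by
      refine Summable.of_norm ?_
      refine h0.summable.congr fun k => ?_
      rw [norm_mul, norm_pow, Complex.norm_exp_ofReal_mul_I, one_pow, mul_one, Complex.norm_real,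
        Real.norm_of_nonneg (hp k)]
    have e : ∀ k : ℕ, (p k : ℂ) * Complex.exp ((((k : ℝ) - 1) * t : ℝ) * Complex.I) =
        (p k : ℂ) * Complex.exp (t * Complex.I) ^ k * Complex.exp (-(t * Complex.I)) := by
      intro k
      rw [← Complex.exp_nat_mul, mul_assoc, ← Complex.exp_add]
      push_cast
      ring_nf
    simp only [e]
    exact hs.hasSum.mul_right _
  have hpoly : HasSum (fun k : ℕ => (p k : ℂ) * (1 + ((((k : ℝ) - 1) * t : ℝ) : ℂ) * Complex.I -
      ((((k : ℝ) - 1) * t : ℝ) : ℂ) ^ 2 / 2)) (1 - (v : ℂ) * (t : ℂ) ^ 2 / 2) := by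
    have a0 := Complex.hasSum_ofReal.2 h0
    have a1 := Complex.hasSum_ofReal.2 h1
    have a2 := Complex.hasSum_ofReal.2 h2
    have := (a0.add ((a1.sub a0).mul_right (t * Complex.I))).sub (a2.mul_right ((t : ℂ) ^ 2 / 2))
    have e : ∀ k : ℕ, (p k : ℂ) * (1 + ((((k : ℝ) - 1) * t : ℝ) : ℂ) * Complex.I -
        ((((k : ℝ) - 1) * t : ℝ) : ℂ) ^ 2 / 2) = (p k : ℂ) + (((k * p k : ℝ) : ℂ) - (p k : ℂ)) *
          (t * Complex.I) - ((((k : ℝ) - 1) ^ 2 * p k : ℝ) : ℂ) * ((t : ℂ) ^ 2 / 2) := by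
      intro k
      push_cast
      ring
    simp only [e]
    rwa [Complex.ofReal_one, sub_self, zero_mul, add_zero, ← mul_div_assoc] at this
  refine (HasSum.norm_le_of_bounded (hchar.sub hpoly)
    ((hS.hasSum.mul_left 4).mul_right (|t| ^ 3)) fun k => ?_).trans ?_
  · rw [← mul_sub, norm_mul, Complex.norm_real, Real.norm_of_nonneg (hp k)]
    refine (mul_le_mul_of_nonneg_left (norm_exp_mul_I_sub_taylor_le _) (hp k)).trans_eq ?_
    rw [abs_mul, mul_pow]
    ring
  · have := pow_nonneg (abs_nonneg t) 3
    linarith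

theorem exists_norm_le_exp_neg_mul_sq {ψ : ℝ → ℂ} {b v K : ℝ} (hψ : Continuous ψ) (hb : 0 < b)
    (hv : 0 < v) (hK : 0 < K) (htay : ∀ t : ℝ, ‖ψ t - (1 - v * t ^ 2 / 2)‖ ≤ K * |t| ^ 3)
    (hlt : ∀ t, t ≠ 0 → |t| ≤ b → ‖ψ t‖ < 1) :
    ∃ c : ℝ, 0 < c ∧ ∀ t, |t| ≤ b → ‖ψ t‖ ≤ Real.exp (-c * t ^ 2) := by
  obtain ⟨δ, hδ, hδ1, hδ2⟩ : ∃ δ : ℝ, 0 < δ ∧ K * δ ≤ v / 4 ∧ v * δ ^ 2 / 2 ≤ 1 := by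
    refine ⟨min (v / (4 * K)) (min 1 (1 / v)), by positivity, ?_, ?_⟩
    · calc K * min (v / (4 * K)) (min 1 (1 / v)) ≤ K * (v / (4 * K)) := by
            gcongr; exact min_le_left _ _
        _ = v / 4 := by field_simp
    · set m := min (v / (4 * K)) (min 1 (1 / v)) with hm
      have hm0 : 0 < m := by positivity
      have m1 : m ≤ 1 := (min_le_right _ _).trans (min_le_left _ _)
      have m2 : m ≤ 1 / v := (min_le_right _ _).trans (min_le_right _ _)
      have : v * m ≤ 1 := by
        calc v * m ≤ v * (1 / v) := by gcongr
          _ = 1 := by field_simp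
      nlinarith
  have hnear : ∀ t, |t| ≤ δ → ‖ψ t‖ ≤ Real.exp (-(v / 4) * t ^ 2) := by
    intro t ht
    have hsq : t ^ 2 ≤ δ ^ 2 := sq_le_sq' (abs_le.1 ht).1 (abs_le.1 ht).2
    have h1 : ‖(1 - v * t ^ 2 / 2 : ℂ)‖ = 1 - v * t ^ 2 / 2 := by
      rw [show (1 - v * t ^ 2 / 2 : ℂ) = ((1 - v * t ^ 2 / 2 : ℝ) : ℂ) by push_cast; ring,
        Complex.norm_real, Real.norm_of_nonneg]
      nlinarith
    have h2 : ‖ψ t‖ ≤ (1 - v * t ^ 2 / 2) + K * |t| ^ 3 := by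
      calc ‖ψ t‖ = ‖(1 - v * t ^ 2 / 2 : ℂ) + (ψ t - (1 - v * t ^ 2 / 2))‖ := by congr 1; ring
        _ ≤ _ := (norm_add_le _ _).trans (by rw [h1]; gcongr; exact htay t)
    have h3 : K * |t| ^ 3 ≤ v / 4 * t ^ 2 := by
      have : K * |t| ^ 3 = (K * |t|) * t ^ 2 := by rw [← sq_abs t]; ring
      rw [this]
      gcongr
      exact (mul_le_mul_of_nonneg_left ht hK.le).trans hδ1
    refine (h2.trans ?_).trans (Real.add_one_le_exp _)
    linarith
  obtain ⟨ρ, hρ0, hρ1, hρ⟩ : ∃ ρ : ℝ, 0 ≤ ρ ∧ ρ < 1 ∧ ∀ t, δ ≤ |t| → |t| ≤ b → ‖ψ t‖ ≤ ρ := by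
    have hc : IsCompact {t : ℝ | δ ≤ |t| ∧ |t| ≤ b} := by
      refine Metric.isCompact_of_isClosed_isBounded ?_ ?_
      · exact (isClosed_le continuous_const continuous_abs).inter
          (isClosed_le continuous_abs continuous_const)
      · refine (Metric.isBounded_Icc (-b) b).subset fun t ht => abs_le.1 ht.2
    rcases Set.eq_empty_or_nonempty {t : ℝ | δ ≤ |t| ∧ |t| ≤ b} with he | hne
    · refine ⟨0, le_rfl, one_pos, fun t h1 h2 => ?_⟩
      have : t ∈ {t : ℝ | δ ≤ |t| ∧ |t| ≤ b} := ⟨h1, h2⟩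
      rw [he] at this
      exact this.elim
    · obtain ⟨s, hs, hmax⟩ := hc.exists_isMaxOn hne hψ.norm.continuousOn
      refine ⟨‖ψ s‖, norm_nonneg _, hlt s ?_ hs.2, fun t h1 h2 => hmax ⟨h1, h2⟩⟩
      rintro rfl
      have := hs.1
      rw [abs_zero] at this
      linarith
  have hρb : 0 < (1 - ρ) / b ^ 2 := div_pos (by linarith) (by positivity)
  refine ⟨min (v / 4) ((1 - ρ) / b ^ 2), by positivity, fun t ht => ?_⟩
  rcases le_total |t| δ with h | h
  · refine (hnear t h).trans (Real.exp_le_exp.2 ?_)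
    have := min_le_left (v / 4) ((1 - ρ) / b ^ 2)
    nlinarith [sq_nonneg t]
  · refine (hρ t h ht).trans ?_
    have hsq : t ^ 2 ≤ b ^ 2 := sq_le_sq' (abs_le.1 ht).1 (abs_le.1 ht).2
    have h4 : min (v / 4) ((1 - ρ) / b ^ 2) * t ^ 2 ≤ 1 - ρ := by
      calc min (v / 4) ((1 - ρ) / b ^ 2) * t ^ 2 ≤ (1 - ρ) / b ^ 2 * b ^ 2 := by
            gcongr; exact min_le_right _ _
        _ = 1 - ρ := by field_simp
    refine le_trans ?_ (Real.add_one_le_exp _)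
    linarith

theorem tendsto_sqrt_mul_integral_pow {ψ : ℝ → ℂ} {b v K c : ℝ} (hψ : Continuous ψ) (hb : 0 < b)
    (hv : 0 < v) (hc : 0 < c) (htay : ∀ t : ℝ, ‖ψ t - (1 - v * t ^ 2 / 2)‖ ≤ K * |t| ^ 3)
    (hle : ∀ t, |t| ≤ b → ‖ψ t‖ ≤ Real.exp (-c * t ^ 2)) :
    Filter.Tendsto (fun N : ℕ => (√(N : ℝ) : ℂ) *
        ∫ t in (-b)..b, ψ t ^ N * Complex.exp (t * Complex.I))
      Filter.atTop (nhds ((√(2 * Real.pi / v) : ℝ) : ℂ)) := by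
  let F : ℕ → ℝ → ℂ := fun N => (Set.Ioc (-b * √(N : ℝ)) (b * √(N : ℝ))).indicator fun s =>
    ψ (s / √(N : ℝ)) ^ N * Complex.exp ((s / √(N : ℝ) : ℝ) * Complex.I)
  have hsqrt : Filter.Tendsto (fun N : ℕ => √(N : ℝ)) Filter.atTop Filter.atTop :=
    Real.tendsto_sqrt_atTop.comp tendsto_natCast_atTop_atTop
  have hpt : ∀ s : ℝ, Filter.Tendsto (fun N => F N s) Filter.atTop
      (nhds ((Real.exp (-(v / 2) * s ^ 2) : ℝ) : ℂ)) := by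
    intro s
    have hs0 : Filter.Tendsto (fun N : ℕ => s / √(N : ℝ)) Filter.atTop (nhds 0) :=
      hsqrt.const_div_atTop s
    have h1 : Filter.Tendsto (fun N : ℕ => (N : ℂ) * (ψ (s / √(N : ℝ)) - 1)) Filter.atTop
        (nhds ((-(v / 2) * s ^ 2 : ℝ) : ℂ)) := by
      rw [tendsto_iff_norm_sub_tendsto_zero]
      refine squeeze_zero' (Filter.Eventually.of_forall fun _ => norm_nonneg _)
        (g := fun N : ℕ => (K * s ^ 2) * |s / √(N : ℝ)|) ?_ ?_
      · filter_upwards [Filter.eventually_gt_atTop 0] with N hN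
        have hN' : (0 : ℝ) < N := by exact_mod_cast hN
        have hsq : (s / √(N : ℝ)) ^ 2 = s ^ 2 / N := by rw [div_pow, Real.sq_sqrt hN'.le]
        have e : (N : ℂ) * (ψ (s / √(N : ℝ)) - 1) - ((-(v / 2) * s ^ 2 : ℝ) : ℂ) =
            ((N : ℝ) : ℂ) * (ψ (s / √(N : ℝ)) - (1 - v * ((s / √(N : ℝ) : ℝ) : ℂ) ^ 2 / 2)) := by
          rw [← Complex.ofReal_pow, hsq]
          have : (N : ℂ) ≠ 0 := by exact_mod_cast hN.ne'
          push_cast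
          field_simp
          ring
        rw [e, norm_mul, Complex.norm_real, Real.norm_of_nonneg hN'.le]
        refine (mul_le_mul_of_nonneg_left (htay _) hN'.le).trans_eq ?_
        have e2 : |s / √(N : ℝ)| ^ 3 = |s / √(N : ℝ)| * (s ^ 2 / N) := by
          rw [← hsq, ← sq_abs (s / √(N : ℝ))]; ring
        rw [e2]
        field_simp
      · simpa using hs0.abs.const_mul (K * s ^ 2)
    have h2 := Complex.tendsto_one_add_pow_exp_of_tendsto h1
    have h3 : Filter.Tendsto (fun N : ℕ => Complex.exp ((s / √(N : ℝ) : ℝ) * Complex.I))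
        Filter.atTop (nhds 1) := by
      have hcont : Continuous fun x : ℝ => Complex.exp (x * Complex.I) := by fun_prop
      have := (hcont.tendsto 0).comp hs0
      rw [Complex.ofReal_zero, zero_mul, Complex.exp_zero] at this
      exact this
    have h4 := h2.mul h3
    rw [mul_one, ← Complex.ofReal_exp] at h4
    refine h4.congr' ?_
    filter_upwards [hsqrt.eventually_gt_atTop (|s| / b)] with N hN
    rw [div_lt_iff₀ hb, mul_comm, abs_lt] at hN
    simp only [F]
    have hmem : s ∈ Set.Ioc (-b * √(N : ℝ)) (b * √(N : ℝ)) := ⟨by linarith, hN.2.le⟩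
    rw [Set.indicator_of_mem hmem, add_sub_cancel]
  have hbound : ∀ N : ℕ, 0 < N → ∀ s : ℝ, ‖F N s‖ ≤ Real.exp (-c * s ^ 2) := by
    intro N hN s
    have hN' : (0 : ℝ) < N := by exact_mod_cast hN
    by_cases hs : s ∈ Set.Ioc (-b * √(N : ℝ)) (b * √(N : ℝ))
    · have hsb : |s / √(N : ℝ)| ≤ b := by
        rw [abs_div, abs_of_pos (Real.sqrt_pos.2 hN'), div_le_iff₀ (Real.sqrt_pos.2 hN'), abs_le]
        exact ⟨by linarith [hs.1], hs.2⟩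
      simp only [F]
      rw [Set.indicator_of_mem hs, norm_mul, Complex.norm_exp_ofReal_mul_I, mul_one, norm_pow]
      refine (pow_le_pow_left₀ (norm_nonneg _) (hle _ hsb) N).trans_eq ?_
      rw [← Real.exp_nat_mul, div_pow, Real.sq_sqrt hN'.le]
      congr 1
      field_simp
    · simp only [F]
      rw [Set.indicator_of_notMem hs, norm_zero]
      positivity
  have hlim := MeasureTheory.tendsto_integral_filter_of_dominated_convergence
    (μ := MeasureTheory.volume) (F := F) (l := Filter.atTop)
    (f := fun s => ((Real.exp (-(v / 2) * s ^ 2) : ℝ) : ℂ)) (fun s => Real.exp (-c * s ^ 2))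
    (Filter.Eventually.of_forall fun N => by
      refine Continuous.aestronglyMeasurable ?_ |>.indicator measurableSet_Ioc
      fun_prop)
    (by
      filter_upwards [Filter.eventually_gt_atTop 0] with N hN
      exact Filter.Eventually.of_forall (hbound N hN))
    (integrable_exp_neg_mul_sq hc) (Filter.Eventually.of_forall hpt)
  rw [integral_complex_ofReal, integral_gaussian,
    show Real.pi / (v / 2) = 2 * Real.pi / v by field_simp] at hlim
  refine hlim.congr' ?_
  filter_upwards [Filter.eventually_gt_atTop 0] with N hN
  have hN' : (0 : ℝ) < √(N : ℝ) := Real.sqrt_pos.2 (by exact_mod_cast hN)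
  simp only [F]
  rw [MeasureTheory.integral_indicator measurableSet_Ioc,
    ← intervalIntegral.integral_of_le (by nlinarith)]
  rw [intervalIntegral.integral_comp_div
    (fun t : ℝ => ψ t ^ N * Complex.exp (t * Complex.I)) hN'.ne', Complex.real_smul,
    mul_div_cancel_right₀ _ hN'.ne', mul_div_cancel_right₀ _ hN'.ne']

open PowerSeries in
theorem tendsto_sqrt_mul_coeff_pow {p : ℕ → ℝ} {v : ℝ} {d : ℕ} (hp : ∀ k, 0 ≤ p k)
    (hp0 : 0 < p 0) (h0 : HasSum p 1)
    (h1 : HasSum (fun k : ℕ => (k : ℝ) * p k) 1) (h2 : HasSum (fun k : ℕ => ((k : ℝ) - 1) ^ 2 * p k) v)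
    (h3 : Summable fun k : ℕ => (k : ℝ) ^ 3 * p k) (hd : 0 < d) (hdvd : ∀ k, p k ≠ 0 → d ∣ k)
    (hgcd : ∀ m : ℕ, (∀ k, p k ≠ 0 → m ∣ k) → m ∣ d) :
    Filter.Tendsto (fun n : ℕ => √((n : ℝ) + 1) * coeff n (PowerSeries.mk p ^ (n + 1)))
      (Filter.atTop ⊓ Filter.principal {n : ℕ | d ∣ n})
      (nhds (d / √(2 * Real.pi * v))) := by
  have hv : 0 < v := by
    refine hp0.trans_le ?_
    have := le_hasSum h2 0 fun k _ => mul_nonneg (sq_nonneg _) (hp k)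
    simpa using this
  have hdR : (0 : ℝ) < d := by exact_mod_cast hd
  have hb : 0 < Real.pi / d := div_pos Real.pi_pos hdR
  have hnorm : Summable fun k => ‖p k‖ := h0.summable.norm
  obtain ⟨K, hK, htay⟩ := norm_latticeChar_sub_taylor_le hp h0 h1 h2 h3
  have hψ : Continuous fun t : ℝ => latticeChar p t * Complex.exp (-(t * Complex.I)) :=
    (continuous_latticeChar hnorm).mul (by fun_prop)
  have hψn : ∀ t : ℝ, ‖latticeChar p t * Complex.exp (-(t * Complex.I))‖ = ‖latticeChar p t‖ := by
    intro t
    rw [norm_mul, show -((t : ℂ) * Complex.I) = ((-t : ℝ) : ℂ) * Complex.I by push_cast; ring,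
      Complex.norm_exp_ofReal_mul_I, mul_one]
  obtain ⟨c, hc, hle⟩ := exists_norm_le_exp_neg_mul_sq hψ hb hv hK htay fun t ht htb => by
    rw [hψn]
    exact norm_latticeChar_lt_one hp hp0 h0 hd hgcd ht htb
  have hlim := (tendsto_sqrt_mul_integral_pow hψ hb hv hc htay hle).comp
    (Filter.tendsto_add_atTop_nat 1)
  have hre := ((Complex.continuous_re.tendsto _).comp hlim).const_mul (d / (2 * Real.pi))
  have hval : d / (2 * Real.pi) * (((√(2 * Real.pi / v) : ℝ) : ℂ)).re =
      d / √(2 * Real.pi * v) := by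
    rw [Complex.ofReal_re, Real.sqrt_div' _ hv.le, Real.sqrt_mul' _ hv.le]
    have h2pi : √(2 * Real.pi) ^ 2 = 2 * Real.pi := Real.sq_sqrt (by positivity)
    have : 0 < √(2 * Real.pi) := by positivity
    have : 0 < √v := by positivity
    nth_rewrite 1 [← h2pi]
    field_simp
  rw [hval] at hre
  refine (hre.mono_left inf_le_left).congr' ?_
  refine Filter.eventually_inf_principal.2 (Filter.Eventually.of_forall fun n hn => ?_)
  have hcauchy := integral_latticeChar_pow hnorm hd hdvd (n + 1) n hn
  have e : ∀ t : ℝ, (latticeChar p t * Complex.exp (-(t * Complex.I))) ^ (n + 1) *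
      Complex.exp (t * Complex.I) =
        latticeChar p t ^ (n + 1) * Complex.exp (-(n * t * Complex.I)) := by
    intro t
    rw [mul_pow, ← Complex.exp_nat_mul, mul_assoc, ← Complex.exp_add]
    push_cast
    ring_nf
  simp only [Function.comp_apply, e]
  rw [hcauchy, ← Complex.ofReal_mul, Complex.ofReal_re]
  push_cast
  field_simp

theorem hasDerivAt_tsum_mul_pow_sub {a : ℕ → ℝ} {r : ℝ} (hr : 0 < r) (j : ℕ)
    (h : Summable fun k : ℕ => |a k| * k * r ^ k)
    {z : ℝ} (hz : z ∈ Metric.ball 0 r) :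
    HasDerivAt (fun y => ∑' k, a k * y ^ (k - j))
      (∑' k, a k * (((k - j : ℕ) : ℝ) * z ^ (k - j - 1))) z := by
  refine hasDerivAt_tsum_of_isPreconnected (t := Metric.ball 0 r) (y₀ := 0)
    (h.mul_right (r ^ (j + 1))⁻¹) Metric.isOpen_ball (convex_ball _ _).isPreconnected
    (fun k y _ => (hasDerivAt_pow (k - j) y).const_mul (a k)) (fun k y hy => ?_)
    (Metric.mem_ball_self hr) ?_ hz
  · rw [mem_ball_zero_iff, Real.norm_eq_abs] at hy
    rw [norm_mul, norm_mul, norm_pow, Real.norm_eq_abs, Real.norm_eq_abs, Real.norm_eq_abs,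
      Nat.abs_cast, mul_assoc, mul_assoc]
    refine mul_le_mul_of_nonneg_left ?_ (abs_nonneg _)
    rcases Nat.lt_or_ge j k with hk | hk
    · obtain ⟨i, rfl⟩ := Nat.exists_eq_add_of_lt hk
      have e1 : j + i + 1 - j - 1 = i := by lia
      have e2 : r ^ (j + i + 1) * (r ^ (j + 1))⁻¹ = r ^ i := by
        rw [show j + i + 1 = i + (j + 1) by ring, pow_add]
        field_simp
      rw [e1, e2]
      gcongr
      exact Nat.sub_le _ _
    · rw [Nat.sub_eq_zero_of_le hk, Nat.cast_zero, zero_mul]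
      positivity
  · refine summable_of_hasFiniteSupport ((Set.finite_Iic j).subset fun k hk => ?_)
    by_contra hkj
    rw [Set.mem_Iic, not_le] at hkj
    rw [Function.mem_support, zero_pow (by lia), mul_zero] at hk
    exact hk rfl

theorem exists_gt_summable_indicator {A : Set ℕ} {ξ : ℝ} (hξ : 0 < ξ)
    (h : Summable fun i : A => (i : ℝ) * ξ ^ (i : ℕ)) :
    ∃ r, ξ < r ∧ ∀ j : ℕ, Summable fun k : ℕ => A.indicator 1 k * ((k : ℝ) ^ j * r ^ k) := by
  rcases A.finite_or_infinite with hA | hA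
  · refine ⟨ξ + 1, by linarith, fun j => summable_of_hasFiniteSupport (hA.subset fun k hk => ?_)⟩
    exact Set.mem_of_indicator_ne_zero (left_ne_zero_of_mul hk)
  · have hlt : ξ < 1 := by
      by_contra! hge
      have h1 := (summable_subtype_iff_indicator (f := fun k : ℕ => (k : ℝ) * ξ ^ k)).1 h
      have h2 := (h1.tendsto_atTop_zero.eventually (gt_mem_nhds one_pos))
      obtain ⟨N, hN⟩ := Filter.eventually_atTop.1 h2
      obtain ⟨k, hk, hkN⟩ := hA.exists_gt N
      have h3 := hN k hkN.le
      rw [Set.indicator_of_mem hk] at h3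
      have h4 : (1 : ℝ) ≤ k := by exact_mod_cast (Nat.zero_le N).trans_lt hkN
      have h5 : 1 ≤ ξ ^ k := one_le_pow₀ hge
      nlinarith
    refine ⟨(1 + ξ) / 2, by linarith, fun j => ?_⟩
    refine Summable.of_nonneg_of_le (fun k => ?_) (fun k => ?_)
      (summable_pow_mul_geometric_of_norm_lt_one j (r := (1 + ξ) / 2) ?_)
    · exact mul_nonneg (Set.indicator_nonneg (fun _ _ => zero_le_one) _) (by positivity)
    · refine mul_le_of_le_one_left (by positivity) ?_
      exact Set.indicator_le' (g := 1) (fun _ _ => le_rfl) (fun _ _ => zero_le_one) k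
    · rw [Real.norm_of_nonneg (by linarith)]
      linarith

theorem sq_mul_deriv_deriv_eq {A : Set ℕ} {ξ r : ℝ} (hξ : 0 < ξ) (hr : ξ < r)
    (h : ∀ j : ℕ, Summable fun k : ℕ => A.indicator 1 k * ((k : ℝ) ^ j * r ^ k))
    {Φ : ℝ → ℝ} (hΦ : ∀ z : ℝ, Φ z = 1 + ∑' i : A, z ^ (i : ℕ)) :
    ξ ^ 2 * deriv (deriv Φ) ξ =
      ∑' k : ℕ, A.indicator 1 k * ((k : ℝ) * ((k : ℝ) - 1) * ξ ^ k) := by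
  set a : ℕ → ℝ := A.indicator 1 with ha
  have ha0 : ∀ k, 0 ≤ a k := fun k => Set.indicator_nonneg (fun _ _ => zero_le_one) _
  have hr0 : 0 < r := hξ.trans hr
  have hΦ' : Φ = fun z => 1 + ∑' k, a k * z ^ (k - 0) := by
    funext z
    rw [hΦ, tsum_subtype A fun k => z ^ k]
    congr 1
    refine tsum_congr fun k => ?_
    by_cases hk : k ∈ A <;> simp [ha, hk]
  have hd1 : ∀ z ∈ Metric.ball (0 : ℝ) r,
      deriv Φ z = ∑' k, (a k * k) * z ^ (k - 1) := by
    intro z hz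
    rw [hΦ']
    have := (hasDerivAt_tsum_mul_pow_sub hr0 0 (a := a)
      ((h 1).congr fun k => by rw [abs_of_nonneg (ha0 k)]; ring) hz).const_add 1
    rw [this.deriv]
    refine tsum_congr fun k => ?_
    rw [Nat.sub_zero, mul_assoc]
  have hmem : ξ ∈ Metric.ball (0 : ℝ) r := by
    rwa [mem_ball_zero_iff, Real.norm_of_nonneg hξ.le]
  have habs : ∀ k : ℕ, |a k * k| = a k * k := fun k =>
    abs_of_nonneg (mul_nonneg (ha0 k) (Nat.cast_nonneg k))
  have hd2 := hasDerivAt_tsum_mul_pow_sub hr0 1 (a := fun k => a k * k)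
    ((h 2).congr fun k => by rw [habs]; ring) hmem
  have heq : deriv Φ =ᶠ[nhds ξ] fun z => ∑' k, (a k * k) * z ^ (k - 1) :=
    Filter.eventually_of_mem (Metric.isOpen_ball.mem_nhds hmem) hd1
  rw [heq.deriv_eq, hd2.deriv, ← tsum_mul_left]
  refine tsum_congr fun k => ?_
  rcases k with _ | _ | k
  · simp
  · simp
  · rw [show k + 1 + 1 - 1 - 1 = k by lia, show k + 1 + 1 - 1 = k + 1 by lia]
    push_cast
    ring

open PowerSeries in
theorem coeff_mk_mul_pow_div_pow (w : ℕ → ℝ) (x F : ℝ) (N n : ℕ) :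
    coeff n (PowerSeries.mk (fun k => w k * x ^ k / F) ^ N) =
      x ^ n / F ^ N * coeff n (PowerSeries.mk w ^ N) := by
  have : PowerSeries.mk (fun k => w k * x ^ k / F) =
      C F⁻¹ * rescale x (PowerSeries.mk w) := by
    ext k
    rw [coeff_C_mul, coeff_rescale, coeff_mk, coeff_mk]
    ring
  rw [this, mul_pow, ← map_pow, ← map_pow, coeff_C_mul, coeff_rescale, inv_pow]
  ring

/-- asymptotics of the number of non-crossing partitions of `[n]`
with block sizes in `A`, along multiples of `d = gcd(A)`. -/
theorem stmt12 (A : Set ℕ) (hA : A.Nonempty) (hApos : ∀ a ∈ A, 1 ≤ a) (hA1 : A ≠ {1})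
    (ξ : ℝ) (hξpos : 0 < ξ)
    (hξsum : Summable fun i : A => (i : ℝ) * ξ ^ (i : ℕ))
    (hξeq : 1 + ∑' i : A, ξ ^ (i : ℕ) = ∑' i : A, (i : ℝ) * ξ ^ (i : ℕ))
    (d : ℕ) (hd₁ : ∀ a ∈ A, d ∣ a) (hd₂ : ∀ m : ℕ, (∀ a ∈ A, m ∣ a) → m ∣ d)
    (Φ : ℝ → ℝ) (hΦ : ∀ z : ℝ, Φ z = 1 + ∑' i : A, z ^ (i : ℕ)) :
    Filter.Tendsto
      (fun n : ℕ =>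
        ((NCPA A n).card : ℝ) /
          ((d : ℝ) * Real.sqrt (Φ ξ / (2 * Real.pi * deriv (deriv Φ) ξ)) *
            (Φ ξ / ξ) ^ (n + 1) * (n : ℝ) ^ (-(3 : ℝ) / 2)))
      (Filter.atTop ⊓ Filter.principal {n : ℕ | d ∣ n})
      (nhds 1) := by
  obtain ⟨r, hr, hsum⟩ := exists_gt_summable_indicator hξpos hξsum
  have hDD := sq_mul_deriv_deriv_eq hξpos hr hsum hΦ
  set D := deriv (deriv Φ) ξ with hD
  set F := Φ ξ with hF
  set a : ℕ → ℝ := A.indicator 1 with ha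
  have ha0 : ∀ k, 0 ≤ a k := fun k => Set.indicator_nonneg (fun _ _ => zero_le_one) _
  have h0A : 0 ∉ A := fun h => by simpa using hApos 0 h
  have hsumξ : ∀ j : ℕ, Summable fun k : ℕ => a k * ((k : ℝ) ^ j * ξ ^ k) := fun j =>
    Summable.of_nonneg_of_le (fun k => mul_nonneg (ha0 k) (by positivity))
      (fun k => mul_le_mul_of_nonneg_left (by gcongr) (ha0 k)) (hsum j)
  have hs0 : HasSum (fun k => a k * ξ ^ k) (F - 1) := by
    have e : F - 1 = ∑' k, a k * ξ ^ k := by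
      rw [hF, hΦ, add_sub_cancel_left, tsum_subtype A fun k => ξ ^ k]
      refine tsum_congr fun k => ?_
      by_cases hk : k ∈ A <;> simp [ha, hk]
    rw [e]
    exact ((hsumξ 0).congr fun k => by ring).hasSum
  have hs1 : HasSum (fun k : ℕ => a k * (k * ξ ^ k)) F := by
    have e : F = ∑' k : ℕ, a k * (k * ξ ^ k) := by
      rw [hF, hΦ, hξeq, tsum_subtype A fun k : ℕ => (k : ℝ) * ξ ^ k]
      refine tsum_congr fun k => ?_
      by_cases hk : k ∈ A <;> simp [ha, hk]
    rw [e]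
    exact ((hsumξ 1).congr fun k => by ring).hasSum
  have hs2 : HasSum (fun k : ℕ => a k * ((k : ℝ) * ((k : ℝ) - 1) * ξ ^ k)) (ξ ^ 2 * D) := by
    rw [hDD]
    exact (((hsumξ 2).sub (hsumξ 1)).congr fun k => by ring).hasSum
  have hF1 : 1 ≤ F := by
    have := hs0.nonneg fun k => mul_nonneg (ha0 k) (by positivity)
    linarith
  have hF0 : 0 < F := by linarith
  set w : ℕ → ℝ := fun k => if k = 0 ∨ k ∈ A then 1 else 0 with hw
  have hwa : ∀ k, w k = (if k = 0 then 1 else 0) + a k := by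
    intro k
    by_cases hk : k ∈ A
    · have : k ≠ 0 := fun h => h0A (h ▸ hk)
      simp [hw, ha, hk, this]
    · simp [hw, ha, hk]
  set p : ℕ → ℝ := fun k => w k * ξ ^ k / F with hp
  have hw0 : ∀ k, 0 ≤ w k := fun k => by
    rw [hwa]
    exact add_nonneg (by split_ifs <;> norm_num) (ha0 k)
  have hpn : ∀ k, 0 ≤ p k := fun k => div_nonneg (mul_nonneg (hw0 k) (by positivity)) hF0.le
  have hp0 : 0 < p 0 := by simp [hp, hw, hF0]
  have hpne : ∀ k, p k ≠ 0 ↔ k = 0 ∨ k ∈ A := by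
    intro k
    simp [hp, hw, hF0.ne', hξpos.ne', or_iff_not_imp_left]
  have hunit : HasSum (fun k : ℕ => if k = 0 then (1 : ℝ) else 0) 1 := hasSum_ite_eq 0 1
  have hpF : ∀ k, p k = ((if k = 0 then 1 else 0) + a k * ξ ^ k) / F := by
    intro k
    simp only [hp, hwa]
    split_ifs with hk
    · simp [hk]
    · simp
  have hpk : ∀ k : ℕ, (k : ℝ) * p k = a k * (k * ξ ^ k) / F := by
    intro k
    rw [hpF]
    split_ifs with hk
    · simp [hk]
    · ring
  have hP0 : HasSum p 1 := by
    have := (hunit.add hs0).div_const F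
    rw [add_sub_cancel, div_self hF0.ne'] at this
    exact (funext hpF : p = _) ▸ this
  have hP1 : HasSum (fun k : ℕ => (k : ℝ) * p k) 1 := by
    have := hs1.div_const F
    rw [div_self hF0.ne'] at this
    simpa only [hpk] using this
  have hP2 : HasSum (fun k : ℕ => ((k : ℝ) - 1) ^ 2 * p k) (ξ ^ 2 * D / F) := by
    have e : ∀ k : ℕ, ((k : ℝ) - 1) ^ 2 * p k =
        a k * ((k : ℝ) * ((k : ℝ) - 1) * ξ ^ k) / F - k * p k + p k := by
      intro k
      linear_combination ((k : ℝ) - 1) * hpk k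
    simp only [e]
    simpa using ((hs2.div_const F).sub hP1).add hP0
  have hP3 : Summable fun k : ℕ => (k : ℝ) ^ 3 * p k := by
    refine ((hsumξ 3).div_const F).congr fun k => ?_
    linear_combination -(k : ℝ) ^ 2 * hpk k
  have hd : 0 < d := by
    obtain ⟨x, hx⟩ := hA
    exact Nat.pos_of_dvd_of_pos (hd₁ x hx) (hApos x hx)
  have hlim := tendsto_sqrt_mul_coeff_pow hpn hp0 hP0 hP1 hP2 hP3 hd
    (fun k hk => ((hpne k).1 hk).elim (fun h => h ▸ dvd_zero d) (hd₁ k))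
    (fun m hm => hd₂ m fun x hx => hm x ((hpne x).2 (Or.inr hx)))
  have hD0 : 0 < D := by
    have h1 := le_hasSum hP2 0 fun k _ => mul_nonneg (sq_nonneg _) (hpn k)
    have h2 : 0 < ξ ^ 2 * D / F := hp0.trans_le (by simpa using h1)
    have h3 : 0 < ξ ^ 2 * D := by simpa [hF0] using h2
    exact (pos_iff_pos_of_mul_pos h3).1 (by positivity)
  have hdR : (0 : ℝ) < d := by exact_mod_cast hd
  have hconst : (d : ℝ) / √(2 * Real.pi * (ξ ^ 2 * D / F)) =
      d * √(F / (2 * Real.pi * D)) / ξ := by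
    rw [show 2 * Real.pi * (ξ ^ 2 * D / F) = ξ ^ 2 * (F / (2 * Real.pi * D))⁻¹ by field_simp,
      Real.sqrt_mul (sq_nonneg ξ), Real.sqrt_sq hξpos.le, Real.sqrt_inv]
    have : 0 < √(F / (2 * Real.pi * D)) := by positivity
    field_simp
  set S := √(F / (2 * Real.pi * D)) with hS
  have hSpos : 0 < S := by positivity
  rw [hconst] at hlim
  have hratio : Filter.Tendsto (fun n : ℕ => (n : ℝ) / (n + 1) * √((n : ℝ) / (n + 1)))
      (Filter.atTop ⊓ Filter.principal {n : ℕ | d ∣ n}) (nhds 1) := by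
    have h1 := tendsto_natCast_div_add_atTop (1 : ℝ)
    simpa using (h1.mul h1.sqrt).mono_left inf_le_left
  have hfin := (hratio.mul (hlim.div_const (d * S / ξ)))
  rw [div_self (by positivity), mul_one] at hfin
  refine hfin.congr' ?_
  filter_upwards [(Filter.eventually_gt_atTop 0).filter_mono inf_le_left] with n hn
  have hnR : (0 : ℝ) < n := by exact_mod_cast hn
  have hcard := succ_mul_card_NCPA h0A n
  have hcoeff := coeff_mk_mul_pow_div_pow w ξ F (n + 1) n
  have hpow : (n : ℝ) ^ (-(3 : ℝ) / 2) = (n * √(n : ℝ))⁻¹ := by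
    rw [Real.sqrt_eq_rpow, ← Real.rpow_one_add' hnR.le (by norm_num), ← Real.rpow_neg hnR.le]
    norm_num
  have hc : PowerSeries.coeff n (PowerSeries.mk p ^ (n + 1)) =
      ξ ^ n / F ^ (n + 1) * (((n : ℝ) + 1) * (NCPA A n).card) := by
    rw [hcard]
    exact hcoeff
  rw [hc, hpow, Real.sqrt_div hnR.le, div_pow]
  have : 0 < √((n : ℝ) + 1) := by positivity
  have : 0 < √(n : ℝ) := by positivity
  field_simp
  ring
end

section
/- Let w be a weight sequence with w(0) = 1 and w(k) > 0 for some k ≥ 2, and let π be the associated probability measure on ℤ₊ (defined via ρ, Φ, Ψ, ν and ξ as in the context). Then for every integer k ≥ 1, Σ_{P ∈ ℕℂ_n, the block of P containing 1 has size k} Ω^w(P) / Z^w_n converges to k·π(k) as n → ∞ along admissible n; that is, under ℙ^w_n the size of the block containing 1 converges in distribution to the size-biased law k·π(k). -/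
open scoped Classical

/-- The weight of a partition: product of `w(size of B)` over blocks `B`. -/
noncomputable def OmegaP (w : ℕ → ℝ) (P : Finset (Finset ℕ)) : ℝ :=
  ∏ B ∈ P, w B.card

/-- The partition function `Z^w_n` of simply generated non-crossing partitions. -/
noncomputable def Zw (w : ℕ → ℝ) (n : ℕ) : ℝ :=
  ∑ P ∈ NCP n, OmegaP w P

/-- `(limsup_k w(k)^{1/k})` as an extended nonnegative real; `ρ` is its inverse. -/
noncomputable def wLimsup (w : ℕ → ℝ) : ENNReal :=
  Filter.limsup (fun k : ℕ => ENNReal.ofReal (w k ^ (1 / (k : ℝ)))) Filter.atTop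

/-- `π` is the probability measure on `ℤ₊` associated with the weight sequence `w`,
defined via `ρ = (limsup w(k)^{1/k})⁻¹`, `Φ`, `Ψ`, `ν` and `ξ`:
if `ρ = 0` then `π = δ_0`; otherwise `π(k) = w(k) ξ^k / Φ(ξ)` where either
`Ψ(ξ) = 1` (case `ν ≥ 1`) or `ξ = ρ` and `Ψ(ρ) ≤ 1` (case `ν < 1`). -/
def PiSpec (w : ℕ → ℝ) (π : ℕ → ℝ) : Prop :=
  (wLimsup w = ⊤ ∧ π 0 = 1 ∧ ∀ k : ℕ, 1 ≤ k → π k = 0) ∨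
  (wLimsup w ≠ ⊤ ∧ ∃ ξ : ℝ, 0 < ξ ∧ ENNReal.ofReal ξ ≤ (wLimsup w)⁻¹ ∧
    (Summable fun k : ℕ => (k : ℝ) * w k * ξ ^ k) ∧
    (∀ k : ℕ, π k = w k * ξ ^ k / ∑' j : ℕ, w j * ξ ^ j) ∧
    (∑' k : ℕ, (k : ℝ) * w k * ξ ^ k = ∑' k : ℕ, w k * ξ ^ k ∨
      (ENNReal.ofReal ξ = (wLimsup w)⁻¹ ∧
        ∑' k : ℕ, (k : ℝ) * w k * ξ ^ k ≤ ∑' k : ℕ, w k * ξ ^ k)))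

/-- The `j` smallest elements of `C`. -/
def initialPart (C : Finset ℕ) (j : ℕ) : Finset ℕ :=
  C.filter fun x => (C.filter (· < x)).card < j

lemma initialPart_subset (C : Finset ℕ) (j : ℕ) : initialPart C j ⊆ C :=
  Finset.filter_subset _ _

lemma card_initialPart (C : Finset ℕ) (j : ℕ) : (initialPart C j).card = min j C.card := by
  induction C using Finset.induction_on_max with
  | empty => simp [initialPart]
  | insert m C hm ih =>
    have hmC : m ∉ C := fun h => lt_irrefl _ (hm m h)
    have h1 : (insert m C).filter (· < m) = C := by
      ext x; simp only [Finset.mem_filter, Finset.mem_insert]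
      grind
    have h2 : ∀ x ∈ C, (insert m C).filter (· < x) = C.filter (· < x) := by
      intro x hx; ext y; simp only [Finset.mem_filter, Finset.mem_insert]
      have := hm x hx
      grind
    have h3 : C.filter (fun x => ((insert m C).filter (· < x)).card < j) = initialPart C j := by
      unfold initialPart
      exact Finset.filter_congr fun x hx => by rw [h2 x hx]
    have h4 : initialPart (insert m C) j =
        if C.card < j then insert m (initialPart C j) else initialPart C j := by
      rw [initialPart, Finset.filter_insert, h1, h3]
    have h5 : m ∉ initialPart C j := fun h => hmC (initialPart_subset C j h)
    rw [h4, Finset.card_insert_of_notMem hmC]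
    split_ifs with h
    · rw [Finset.card_insert_of_notMem h5, ih]; omega
    · rw [ih]; omega

lemma lt_of_mem_initialPart {C : Finset ℕ} {j x y : ℕ} (hx : x ∈ initialPart C j)
    (hy : y ∈ C) (hy' : y ∉ initialPart C j) : x < y := by
  by_contra! h
  simp only [initialPart, Finset.mem_filter, not_and, not_lt] at hx hy'
  have h1 := hy' hy
  have h2 : C.filter (· < y) ⊆ C.filter (· < x) := fun z hz => by
    rw [Finset.mem_filter] at hz ⊢
    exact ⟨hz.1, hz.2.trans_le h⟩
  have := Finset.card_le_card h2
  omega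

lemma initialPart_eq {C U : Finset ℕ} (hU : U ⊆ C) (h : ∀ x ∈ U, ∀ y ∈ C, y ∉ U → x < y) :
    initialPart C U.card = U := by
  symm
  apply Finset.eq_of_subset_of_card_le
  · intro x hx
    refine Finset.mem_filter.2 ⟨hU hx, ?_⟩
    apply Finset.card_lt_card
    refine ⟨fun y hy => ?_, fun h' => ?_⟩
    · simp only [Finset.mem_filter] at hy
      by_contra hyU
      have := h x hx y hy.1 hyU
      omega
    · have := h' hx
      simp at this
  · rw [card_initialPart]; omega

/-- `insert B Q` is a non-crossing partition of `{a, …, n}` in which `B ∉ Q` is the block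
containing `a`. -/
structure RootedNC (a n : ℕ) (B : Finset ℕ) (Q : Finset (Finset ℕ)) : Prop where
  root_mem : a ∈ B
  root_subset : B ⊆ Finset.Icc a n
  block_subset : ∀ D ∈ Q, D ⊆ Finset.Icc a n
  block_nonempty : ∀ D ∈ Q, D.Nonempty
  root_disjoint : ∀ D ∈ Q, ∀ x ∈ D, x ∉ B
  block_unique : ∀ D ∈ Q, ∀ D' ∈ Q, ∀ x, x ∈ D → x ∈ D' → D = D'
  cover : ∀ x ∈ Finset.Icc a n, x ∈ B ∨ ∃ D ∈ Q, x ∈ D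
  nonCrossing : IsNonCrossing (insert B Q)

/-- The pairs `(B, Q)` with `RootedNC a n B Q` and `B` of size `h`. -/
noncomputable def rootedNC (a n h : ℕ) : Finset (Finset ℕ × Finset (Finset ℕ)) :=
  ((Finset.Icc a n).powerset ×ˢ (Finset.Icc a n).powerset.powerset).filter
    fun p => RootedNC a n p.1 p.2 ∧ p.1.card = h

lemma mem_rootedNC {a n h : ℕ} {p : Finset ℕ × Finset (Finset ℕ)} :
    p ∈ rootedNC a n h ↔ RootedNC a n p.1 p.2 ∧ p.1.card = h := by
  simp only [rootedNC, Finset.mem_filter, Finset.mem_product, Finset.mem_powerset,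
    and_iff_right_iff_imp, and_imp]
  exact fun hp _ => ⟨hp.root_subset, fun D hD => Finset.mem_powerset.2 (hp.block_subset D hD)⟩

lemma RootedNC.root_notMem {a n : ℕ} {B : Finset ℕ} {Q : Finset (Finset ℕ)}
    (h : RootedNC a n B Q) : B ∉ Q :=
  fun hB => h.root_disjoint B hB a h.root_mem h.root_mem

/-- The union of the members of `Q` containing `b`; a single block, or empty. -/
def blockOf (b : ℕ) (Q : Finset (Finset ℕ)) : Finset ℕ :=
  (Q.filter (b ∈ ·)).biUnion id

lemma RootedNC.blockOf_eq {a n b : ℕ} {B D : Finset ℕ} {Q : Finset (Finset ℕ)}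
    (h : RootedNC a n B Q) (hD : D ∈ Q) (hb : b ∈ D) : blockOf b Q = D := by
  ext x
  simp only [blockOf, Finset.mem_biUnion, Finset.mem_filter, id]
  constructor
  · rintro ⟨E, ⟨hE, hbE⟩, hx⟩
    rwa [h.block_unique D hD E hE b hb hbE]
  · exact fun hx => ⟨D, ⟨hD, hb⟩, hx⟩

lemma blockOf_eq_empty {b : ℕ} {Q : Finset (Finset ℕ)} (h : ∀ D ∈ Q, b ∉ D) :
    blockOf b Q = ∅ := by
  rw [blockOf, Finset.filter_false_of_mem h, Finset.biUnion_empty]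

lemma isNonCrossing_mono {P Q : Finset (Finset ℕ)} (h : P ⊆ Q) (hQ : IsNonCrossing Q) :
    IsNonCrossing P :=
  fun B hB B' hB' => hQ B (h hB) B' (h hB')

lemma isNonCrossing_insert {B : Finset ℕ} {Q : Finset (Finset ℕ)} (hQ : IsNonCrossing Q)
    (h1 : ∀ D ∈ Q, ∀ a b c d, a < b → b < c → c < d → a ∈ B → c ∈ B → b ∈ D → d ∈ D → False)
    (h2 : ∀ D ∈ Q, ∀ a b c d, a < b → b < c → c < d → a ∈ D → c ∈ D → b ∈ B → d ∈ B → False) :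
    IsNonCrossing (insert B Q) := by
  intro E hE E' hE' hne
  rw [Finset.mem_insert] at hE hE'
  rcases hE with rfl | hE <;> rcases hE' with rfl | hE'
  · exact absurd rfl hne
  · exact h1 E' hE'
  · exact h2 E hE
  · exact hQ E hE E' hE' hne

namespace RootedNC

variable {a n : ℕ} {B C : Finset ℕ} {Q : Finset (Finset ℕ)}

/-- Removing the root `a` when `a + 1` belongs to its block. -/
lemma erase_root (h : RootedNC a n B Q) (hb : a + 1 ∈ B) :
    RootedNC (a + 1) n (B.erase a) Q := by
  have hQ : ∀ D ∈ Q, ∀ x ∈ D, x ∈ Finset.Icc (a + 1) n := by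
    intro D hD x hx
    have h1 := Finset.mem_Icc.1 (h.block_subset D hD hx)
    have h2 : x ≠ a := fun e => h.root_disjoint D hD x hx (e ▸ h.root_mem)
    rw [Finset.mem_Icc]; omega
  refine ⟨by simp [hb], fun x hx => ?_, hQ, h.block_nonempty, fun D hD x hx hx' =>
    h.root_disjoint D hD x hx (Finset.mem_of_mem_erase hx'), h.block_unique, fun x hx => ?_, ?_⟩
  · have h1 := Finset.mem_Icc.1 (h.root_subset (Finset.mem_of_mem_erase hx))
    have h2 := Finset.ne_of_mem_erase hx
    rw [Finset.mem_Icc]; omega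
  · rw [Finset.mem_Icc] at hx
    have h2 : x ≠ a := by omega
    have := h.cover x (Finset.mem_Icc.2 (by omega))
    simpa [h2] using this
  · refine isNonCrossing_insert (isNonCrossing_mono (Finset.subset_insert _ _) h.nonCrossing)
      (fun D hD x y z u hxy hyz hzu hx hz hy hu => ?_)
      (fun D hD x y z u hxy hyz hzu hx hz hy hu => ?_)
    · exact h.nonCrossing B (by simp) D (by simp [hD]) (fun e => h.root_notMem (e ▸ hD))
        x y z u hxy hyz hzu (Finset.mem_of_mem_erase hx) (Finset.mem_of_mem_erase hz) hy hu
    · exact h.nonCrossing D (by simp [hD]) B (by simp) (fun e => h.root_notMem (e ▸ hD))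
        x y z u hxy hyz hzu hx hz (Finset.mem_of_mem_erase hy) (Finset.mem_of_mem_erase hu)

lemma lt_of_block_succ (h : RootedNC a n B Q) {D : Finset ℕ} (hD : D ∈ Q) (hb : a + 1 ∈ D)
    {x y : ℕ} (hx : x ∈ D) (hy : y ∈ B) (hya : y ≠ a) : x < y := by
  have h1 := Finset.mem_Icc.1 (h.block_subset D hD hx)
  have h2 := Finset.mem_Icc.1 (h.root_subset hy)
  have h3 : x ≠ y := fun e => h.root_disjoint D hD x hx (e ▸ hy)
  have h4 : a + 1 ≠ y := fun e => h.root_disjoint D hD _ hb (e ▸ hy)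
  by_contra! h5
  exact h.nonCrossing B (by simp) D (by simp [hD]) (fun e => h.root_notMem (e ▸ hD))
    a (a + 1) y x (by omega) (by omega) (by omega) h.root_mem hy hb hx

/-- Removing the root `a` and merging the rest of its block with the block of `a + 1`. -/
lemma merge_root (h : RootedNC a n B Q) {D : Finset ℕ} (hD : D ∈ Q) (hb : a + 1 ∈ D) :
    RootedNC (a + 1) n (B.erase a ∪ D) (Q.erase D) := by
  have hQ : ∀ D ∈ Q, ∀ x ∈ D, x ∈ Finset.Icc (a + 1) n := by
    intro D hD x hx
    have h1 := Finset.mem_Icc.1 (h.block_subset D hD hx)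
    have h2 : x ≠ a := fun e => h.root_disjoint D hD x hx (e ▸ h.root_mem)
    rw [Finset.mem_Icc]; omega
  have hBC : ∀ E ∈ Q, B ≠ E := fun E hE e => h.root_notMem (e ▸ hE)
  refine ⟨by simp [hb], fun x hx => ?_, fun E hE => hQ E (Finset.mem_of_mem_erase hE),
    fun E hE => h.block_nonempty E (Finset.mem_of_mem_erase hE), fun E hE x hx hx' => ?_,
    fun E hE E' hE' => h.block_unique E (Finset.mem_of_mem_erase hE) E'
      (Finset.mem_of_mem_erase hE'), fun x hx => ?_, ?_⟩
  · rw [Finset.mem_union] at hx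
    rcases hx with hx | hx
    · have h1 := Finset.mem_Icc.1 (h.root_subset (Finset.mem_of_mem_erase hx))
      have h2 := Finset.ne_of_mem_erase hx
      rw [Finset.mem_Icc]; omega
    · exact hQ D hD x hx
  · rw [Finset.mem_erase] at hE
    rw [Finset.mem_union] at hx'
    rcases hx' with hx' | hx'
    · exact h.root_disjoint E hE.2 x hx (Finset.mem_of_mem_erase hx')
    · exact hE.1 (h.block_unique E hE.2 D hD x hx hx')
  · rw [Finset.mem_Icc] at hx
    have h2 : x ≠ a := by omega
    rcases h.cover x (Finset.mem_Icc.2 (by omega)) with h3 | ⟨E, hE, hxE⟩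
    · left; simp [h2, h3]
    · by_cases hED : E = D
      · left; subst hED; simp [hxE]
      · right; exact ⟨E, Finset.mem_erase.2 ⟨hED, hE⟩, hxE⟩
  · refine isNonCrossing_insert (isNonCrossing_mono
      ((Finset.erase_subset _ _).trans (Finset.subset_insert _ _)) h.nonCrossing)
      (fun E hE x y z u hxy hyz hzu hx hz hy hu => ?_)
      (fun E hE x y z u hxy hyz hzu hx hz hy hu => ?_)
    · rw [Finset.mem_erase] at hE
      have c1 := h.nonCrossing B (by simp) E (by simp [hE.2]) (hBC E hE.2)
      have c2 := h.nonCrossing D (by simp [hD]) E (by simp [hE.2]) (Ne.symm hE.1)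
      have hya := Finset.mem_Icc.1 (hQ E hE.2 y hy)
      simp only [Finset.mem_union, Finset.mem_erase] at hx hz
      rcases hz with hz | hz
      · exact c1 a y z u (by omega) hyz hzu h.root_mem hz.2 hy hu
      · rcases hx with hx | hx
        · have := h.lt_of_block_succ hD hb hz hx.2 hx.1
          omega
        · exact c2 x y z u hxy hyz hzu hx hz hy hu
    · rw [Finset.mem_erase] at hE
      have c1 := h.nonCrossing E (by simp [hE.2]) B (by simp) (hBC E hE.2).symm
      have c2 := h.nonCrossing D (by simp [hD]) E (by simp [hE.2]) (Ne.symm hE.1)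
      have c3 := h.nonCrossing E (by simp [hE.2]) D (by simp [hD]) hE.1
      have hxa := Finset.mem_Icc.1 (hQ E hE.2 x hx)
      have hxa' : x ≠ a + 1 := fun e => hE.1 (h.block_unique E hE.2 D hD x hx (e ▸ hb))
      simp only [Finset.mem_union, Finset.mem_erase] at hy hu
      rcases hy with hy | hy
      · rcases hu with hu | hu
        · exact c1 x y z u hxy hyz hzu hx hz hy.2 hu.2
        · have := h.lt_of_block_succ hD hb hu hy.2 hy.1
          omega
      · exact c2 (a + 1) x y z (by omega) hxy hyz hb hy hx hz

lemma notMem_of_succ (h : RootedNC (a + 1) n C Q) {D : Finset ℕ} (hD : D ∈ insert C Q) :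
    a ∉ D := by
  intro ha
  have : a ∈ Finset.Icc (a + 1) n := by
    rcases Finset.mem_insert.1 hD with rfl | hD
    · exact h.root_subset ha
    · exact h.block_subset D hD ha
  rw [Finset.mem_Icc] at this; omega

/-- Splitting the `U` initial elements off the root block and adding a new root `a` to the rest. -/
lemma isNonCrossing_split (h : RootedNC (a + 1) n C Q) {U : Finset ℕ} (hU : U ⊆ C)
    (hlt : ∀ x ∈ U, ∀ y ∈ C, y ∉ U → x < y) :
    IsNonCrossing (insert (insert a (C \ U)) (insert U Q)) := by
  have hCa : ∀ x ∈ C, a + 1 ≤ x := fun x hx => (Finset.mem_Icc.1 (h.root_subset hx)).1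
  have hCQ : ∀ E ∈ Q, C ≠ E := fun E hE e => h.root_notMem (e ▸ hE)
  refine isNonCrossing_insert (isNonCrossing_insert
    (isNonCrossing_mono (Finset.subset_insert _ _) h.nonCrossing)
    (fun E hE x y z u hxy hyz hzu hx hz hy hu => ?_)
    (fun E hE x y z u hxy hyz hzu hx hz hy hu => ?_))
    (fun E hE x y z u hxy hyz hzu hx hz hy hu => ?_)
    (fun E hE x y z u hxy hyz hzu hx hz hy hu => ?_)
  · exact h.nonCrossing C (by simp) E (by simp [hE]) (hCQ E hE) x y z u hxy hyz hzu
      (hU hx) (hU hz) hy hu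
  · exact h.nonCrossing E (by simp [hE]) C (by simp) (hCQ E hE).symm x y z u hxy hyz hzu
      hx hz (hU hy) (hU hu)
  · simp only [Finset.mem_insert, Finset.mem_sdiff] at hx hz hE
    have hz' : z ∈ C ∧ z ∉ U := by
      rcases hz with rfl | hz
      · rcases hx with rfl | hx
        · omega
        · have := hCa x hx.1; omega
      · exact hz
    rcases hE with rfl | hE
    · have := hlt u hu z hz'.1 hz'.2
      omega
    · have c := h.nonCrossing C (by simp) E (by simp [hE]) (hCQ E hE)
      rcases hx with rfl | hx
      · have hy1 := (Finset.mem_Icc.1 (h.block_subset E hE hy)).1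
        have hy2 : y ≠ x + 1 := fun e => h.root_disjoint E hE y hy (e ▸ h.root_mem)
        exact c (x + 1) y z u (by omega) hyz hzu h.root_mem hz'.1 hy hu
      · exact c x y z u hxy hyz hzu hx.1 hz'.1 hy hu
  · simp only [Finset.mem_insert, Finset.mem_sdiff] at hy hu hE
    have hxa : a + 1 ≤ x := by
      rcases hE with rfl | hE
      · exact hCa x (hU hx)
      · exact (Finset.mem_Icc.1 (h.block_subset E hE hx)).1
    have hy' : y ∈ C ∧ y ∉ U := hy.resolve_left (by omega)
    have hu' : u ∈ C ∧ u ∉ U := hu.resolve_left (by omega)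
    rcases hE with rfl | hE
    · have := hlt z hz y hy'.1 hy'.2
      omega
    · exact h.nonCrossing E (by simp [hE]) C (by simp) (hCQ E hE).symm x y z u hxy hyz hzu
        hx hz hy'.1 hu'.1

lemma insert_root (h : RootedNC (a + 1) n C Q) : RootedNC a n (insert a C) Q := by
  have hn := Finset.mem_Icc.1 (h.root_subset h.root_mem)
  refine ⟨by simp, ?_, fun D hD => (h.block_subset D hD).trans (Finset.Icc_subset_Icc_left (by omega)),
    h.block_nonempty, fun D hD x hx hx' => ?_, h.block_unique, fun x hx => ?_, ?_⟩
  · refine Finset.insert_subset (Finset.mem_Icc.2 (by omega))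
      (h.root_subset.trans (Finset.Icc_subset_Icc_left (by omega)))
  · rcases Finset.mem_insert.1 hx' with rfl | hx'
    · exact h.notMem_of_succ (Finset.mem_insert_of_mem hD) hx
    · exact h.root_disjoint D hD x hx hx'
  · by_cases hxa : x = a
    · simp [hxa]
    · rw [Finset.mem_Icc] at hx
      rcases h.cover x (Finset.mem_Icc.2 (by omega)) with h3 | h3
      · left; simp [h3]
      · exact Or.inr h3
  · refine isNonCrossing_mono ?_ (h.isNonCrossing_split (U := ∅) (by simp) (by simp))
    rw [Finset.sdiff_empty]
    exact Finset.insert_subset_insert _ (Finset.subset_insert _ _)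

lemma split_root (h : RootedNC (a + 1) n C Q) {U : Finset ℕ} (hU : U ⊆ C)
    (hlt : ∀ x ∈ U, ∀ y ∈ C, y ∉ U → x < y) (hne : U.Nonempty) :
    RootedNC a n (insert a (C \ U)) (insert U Q) := by
  have hn := Finset.mem_Icc.1 (h.root_subset h.root_mem)
  have hsub : Finset.Icc (a + 1) n ⊆ Finset.Icc a n := Finset.Icc_subset_Icc_left (by omega)
  have haC : a ∉ C := h.notMem_of_succ (by simp)
  refine ⟨by simp, Finset.insert_subset (Finset.mem_Icc.2 (by omega))
    ((Finset.sdiff_subset.trans h.root_subset).trans hsub), ?_, ?_, ?_, ?_, ?_,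
    h.isNonCrossing_split hU hlt⟩
  · exact Finset.forall_mem_insert _ _ _ |>.2 ⟨(hU.trans h.root_subset).trans hsub,
      fun D hD => (h.block_subset D hD).trans hsub⟩
  · exact Finset.forall_mem_insert _ _ _ |>.2 ⟨hne, h.block_nonempty⟩
  · refine Finset.forall_mem_insert _ _ _ |>.2 ⟨fun x hx hx' => ?_, fun D hD x hx hx' => ?_⟩
    · rcases Finset.mem_insert.1 hx' with rfl | hx'
      · exact haC (hU hx)
      · exact (Finset.mem_sdiff.1 hx').2 hx
    · rcases Finset.mem_insert.1 hx' with rfl | hx'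
      · exact h.notMem_of_succ (Finset.mem_insert_of_mem hD) hx
      · exact h.root_disjoint D hD x hx (Finset.mem_sdiff.1 hx').1
  · intro D hD D' hD' x hx hx'
    rcases Finset.mem_insert.1 hD with e | hDQ <;> rcases Finset.mem_insert.1 hD' with e' | hDQ'
    · rw [e, e']
    · exact absurd (hU (e ▸ hx)) (h.root_disjoint D' hDQ' x hx')
    · exact absurd (hU (e' ▸ hx')) (h.root_disjoint D hDQ x hx)
    · exact h.block_unique D hDQ D' hDQ' x hx hx'
  · intro x hx
    by_cases hxa : x = a
    · simp [hxa]
    · rw [Finset.mem_Icc] at hx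
      rcases h.cover x (Finset.mem_Icc.2 (by omega)) with h3 | ⟨D, hD, hxD⟩
      · by_cases hxU : x ∈ U
        · exact Or.inr ⟨U, by simp, hxU⟩
        · left; simp [h3, hxU]
      · exact Or.inr ⟨D, by simp [hD], hxD⟩

end RootedNC
/-- The total weight of `rootedNC a n h`, the root block not being counted. -/
noncomputable def rootedWeight (w : ℕ → ℝ) (a n h : ℕ) : ℝ :=
  ∑ p ∈ rootedNC a n h, OmegaP w p.2

lemma RootedNC.union_eq {a n : ℕ} {B : Finset ℕ} {Q : Finset (Finset ℕ)} (h : RootedNC a n B Q)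
    (han : a < n) :
    (blockOf (a + 1) Q = ∅ ∧ Q.filter (a + 1 ∉ ·) = Q ∧ a + 1 ∈ B) ∨
      (∃ D ∈ Q, a + 1 ∈ D ∧ blockOf (a + 1) Q = D ∧ Q.filter (a + 1 ∉ ·) = Q.erase D) := by
  rcases h.cover (a + 1) (Finset.mem_Icc.2 (by omega)) with hb | ⟨D, hD, hb⟩
  · left
    have h1 : ∀ D ∈ Q, a + 1 ∉ D := fun D hD h' => h.root_disjoint D hD _ h' hb
    exact ⟨blockOf_eq_empty h1, Finset.filter_true_of_mem h1, hb⟩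
  · right
    refine ⟨D, hD, hb, h.blockOf_eq hD hb, ?_⟩
    ext E
    simp only [Finset.mem_filter, Finset.mem_erase]
    constructor
    · rintro ⟨hE, hbE⟩
      exact ⟨fun e => hbE (e ▸ hb), hE⟩
    · rintro ⟨hne, hE⟩
      exact ⟨hE, fun hbE => hne (h.block_unique E hE D hD _ hbE hb)⟩

lemma rootedWeight_succ (w : ℕ → ℝ) (hw0 : w 0 = 1) {a n : ℕ} (han : a < n) (h : ℕ) :
    rootedWeight w a n (h + 1) =
      ∑ j ∈ Finset.range (n - a + 1), w j * rootedWeight w (a + 1) n (h + j) := by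
  simp only [rootedWeight, Finset.mul_sum]
  rw [Finset.sum_sigma']
  refine Finset.sum_bij'
    (fun p _ => ⟨(blockOf (a + 1) p.2).card,
      (p.1.erase a ∪ blockOf (a + 1) p.2, p.2.filter (a + 1 ∉ ·))⟩)
    (fun q _ => (insert a (q.2.1 \ initialPart q.2.1 q.1),
      if q.1 = 0 then q.2.2 else insert (initialPart q.2.1 q.1) q.2.2)) ?_ ?_ ?_ ?_ ?_
  · rintro ⟨B, Q⟩ hp
    obtain ⟨hR, hc⟩ := mem_rootedNC.1 hp
    simp only at hR hc
    have hBa : (B.erase a).card = h := by rw [Finset.card_erase_of_mem hR.root_mem, hc]; rfl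
    simp only [Finset.mem_sigma, Finset.mem_range, mem_rootedNC]
    rcases hR.union_eq han with ⟨h1, h2, h3⟩ | ⟨D, hD, h1, h2, h3⟩
    · rw [h1, h2]
      simpa [hBa] using hR.erase_root h3
    · rw [h2, h3]
      have hm := hR.merge_root hD h1
      have hcard : (B.erase a ∪ D).card = h + D.card := by
        rw [Finset.card_union_of_disjoint, hBa]
        rw [Finset.disjoint_right]
        exact fun x hx hx' => hR.root_disjoint D hD x hx (Finset.mem_of_mem_erase hx')
      refine ⟨?_, hm, hcard⟩
      have := Finset.card_le_card hm.root_subset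
      rw [hcard, Nat.card_Icc] at this
      omega
  · rintro ⟨j, C, Q⟩ hq
    simp only [Finset.mem_sigma, Finset.mem_range, mem_rootedNC] at hq ⊢
    obtain ⟨hj, hR, hc⟩ := hq
    have hU := initialPart_subset C j
    have hUc : (initialPart C j).card = j := by rw [card_initialPart]; omega
    have haC : a ∉ C := hR.notMem_of_succ (by simp)
    have hcard : (insert a (C \ initialPart C j)).card = h + 1 := by
      rw [Finset.card_insert_of_notMem (fun h' => haC (Finset.mem_sdiff.1 h').1),
        Finset.card_sdiff_of_subset hU, hUc]
      omega
    refine ⟨?_, hcard⟩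
    split_ifs with hj0
    · have : initialPart C j = ∅ := by rw [← Finset.card_eq_zero, hUc, hj0]
      rw [this, Finset.sdiff_empty]
      exact hR.insert_root
    · exact hR.split_root hU (fun x hx y => lt_of_mem_initialPart hx)
        (Finset.card_pos.1 (by omega))
  · rintro ⟨B, Q⟩ hp
    obtain ⟨hR, hc⟩ := mem_rootedNC.1 hp
    simp only at hR hc ⊢
    rcases hR.union_eq han with ⟨h1, h2, h3⟩ | ⟨D, hD, h1, h2, h3⟩
    · have : initialPart (B.erase a ∪ ∅) 0 = ∅ := by
        rw [← Finset.card_eq_zero, card_initialPart]; simp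
      rw [h1, h2, Finset.card_empty, if_pos rfl, this, Finset.union_empty, Finset.sdiff_empty,
        Finset.insert_erase hR.root_mem]
    · rw [h2, h3, if_neg (Finset.card_ne_zero_of_mem h1), initialPart_eq Finset.subset_union_right,
        Finset.insert_erase hD]
      · congr 1
        ext x
        have h4 := hR.root_disjoint D hD x
        have h5 := hR.root_mem
        simp only [Finset.mem_insert, Finset.mem_sdiff, Finset.mem_union, Finset.mem_erase]
        by_cases hx : x = a
        · simp [hx, h5]
        · tauto
      · intro x hx y hy hyD
        simp only [Finset.mem_union, Finset.mem_erase, hyD, or_false] at hy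
        exact hR.lt_of_block_succ hD h1 hx hy.2 hy.1
  · rintro ⟨j, C, Q⟩ hq
    simp only [Finset.mem_sigma, Finset.mem_range, mem_rootedNC] at hq ⊢
    obtain ⟨hj, hR, hc⟩ := hq
    have hU := initialPart_subset C j
    have hUc : (initialPart C j).card = j := by rw [card_initialPart]; omega
    have haC : a ∉ C := hR.notMem_of_succ (by simp)
    have hQ : ∀ E ∈ Q, a + 1 ∉ E := fun E hE h' => hR.root_disjoint E hE _ h' hR.root_mem
    have herase : (insert a (C \ initialPart C j)).erase a = C \ initialPart C j :=
      Finset.erase_insert fun h' => haC (Finset.mem_sdiff.1 h').1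
    by_cases hj0 : j = 0
    · subst hj0
      have : initialPart C 0 = ∅ := by rw [← Finset.card_eq_zero, hUc]
      rw [this, Finset.sdiff_empty] at herase
      rw [if_pos rfl, blockOf_eq_empty hQ, this, Finset.sdiff_empty, herase, Finset.union_empty,
        Finset.filter_true_of_mem hQ, Finset.card_empty]
    · have hne : (initialPart C j).Nonempty := Finset.card_pos.1 (by omega)
      have hS := hR.split_root hU (fun x hx y => lt_of_mem_initialPart hx) hne
      have hmem : a + 1 ∈ initialPart C j := by
        by_contra hcon
        obtain ⟨x, hx⟩ := hne
        have h1 := lt_of_mem_initialPart hx hR.root_mem hcon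
        have h2 := (Finset.mem_Icc.1 (hR.root_subset (hU hx))).1
        omega
      rw [if_neg hj0, hS.blockOf_eq (Finset.mem_insert_self _ _) hmem, herase, hUc,
        Finset.sdiff_union_of_subset hU, Finset.filter_insert, if_neg (by simpa using hmem),
        Finset.filter_true_of_mem hQ]
  · rintro ⟨B, Q⟩ hp
    obtain ⟨hR, hc⟩ := mem_rootedNC.1 hp
    simp only at hR hc ⊢
    rcases hR.union_eq han with ⟨h1, h2, h3⟩ | ⟨D, hD, h1, h2, h3⟩
    · rw [h1, h2, Finset.card_empty, hw0, one_mul]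
    · rw [h2, h3, OmegaP, OmegaP, Finset.mul_prod_erase Q (fun E => w E.card) hD]

/-- Weights of forests: `forest w n h` is the total weight of the ordered forests with `n` vertices
and `h` trees, a vertex with `j` children having weight `w j`. -/
noncomputable def forest (w : ℕ → ℝ) : ℕ → ℕ → ℝ
  | 0, h => if h = 0 then 1 else 0
  | _ + 1, 0 => 0
  | n + 1, h + 1 => ∑ j ∈ Finset.range (n + 1), w j * forest w n (h + j)

lemma rootedWeight_self (w : ℕ → ℝ) (a h : ℕ) :
    rootedWeight w a a h = if h = 1 then 1 else 0 := by
  have key : ∀ B Q, RootedNC a a B Q → B = {a} ∧ Q = ∅ := by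
    intro B Q hR
    have hB : B = {a} := by
      refine Finset.Subset.antisymm ?_ (by simpa using hR.root_mem)
      simpa using hR.root_subset
    refine ⟨hB, Finset.eq_empty_of_forall_notMem fun D hD => ?_⟩
    obtain ⟨x, hx⟩ := hR.block_nonempty D hD
    have h1 := hR.block_subset D hD hx
    simp only [Finset.Icc_self, Finset.mem_singleton] at h1
    exact hR.root_disjoint D hD x hx (by simp [hB, h1])
  have hR : RootedNC a a {a} ∅ :=
    ⟨by simp, by simp, by simp, by simp, by simp, by simp, by simp, fun B hB B' hB' hne =>
      absurd ((by simpa using hB : B = {a}).trans (by simpa using hB' : B' = {a}).symm) hne⟩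
  split_ifs with hh
  · have : rootedNC a a h = {({a}, ∅)} := by
      ext ⟨B, Q⟩
      rw [mem_rootedNC, Finset.mem_singleton, Prod.mk.injEq]
      constructor
      · exact fun h' => key B Q h'.1
      · rintro ⟨rfl, rfl⟩
        exact ⟨hR, by simp [hh]⟩
    rw [rootedWeight, this, Finset.sum_singleton]
    simp [OmegaP]
  · apply Finset.sum_eq_zero
    rintro ⟨B, Q⟩ hp
    obtain ⟨h1, h2⟩ := mem_rootedNC.1 hp
    have := (key B Q h1).1
    simp only at h2
    rw [this, Finset.card_singleton] at h2
    exact absurd h2.symm hh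

lemma rootedWeight_zero (w : ℕ → ℝ) (a n : ℕ) : rootedWeight w a n 0 = 0 := by
  apply Finset.sum_eq_zero
  rintro ⟨B, Q⟩ hp
  obtain ⟨h1, h2⟩ := mem_rootedNC.1 hp
  exact absurd h2 (Finset.card_ne_zero_of_mem h1.root_mem)

lemma rootedWeight_eq_forest (w : ℕ → ℝ) (hw0 : w 0 = 1) (m : ℕ) :
    ∀ a h, rootedWeight w a (a + m) h = forest w (m + 1) h := by
  induction m with
  | zero =>
    intro a h
    rw [add_zero, rootedWeight_self]
    rcases h with _ | h
    · simp [forest]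
    · simp [forest, hw0]
  | succ m ih =>
    intro a h
    rcases h with _ | h
    · rw [rootedWeight_zero, forest]
    · rw [rootedWeight_succ w hw0 (by omega), forest, Nat.add_sub_cancel_left]
      refine Finset.sum_congr rfl fun j _ => ?_
      rw [← ih (a + 1), show a + 1 + m = a + (m + 1) by ring]

lemma mem_NCP {n : ℕ} {P : Finset (Finset ℕ)} :
    P ∈ NCP n ↔ IsPartitionOf n P ∧ IsNonCrossing P := by
  simp only [NCP, Finset.mem_filter, Finset.mem_powerset, and_iff_right_iff_imp]
  exact fun h B hB => Finset.mem_powerset.2 (h.1.1 B hB).1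

lemma rootedNC_one_iff {n : ℕ} {B : Finset ℕ} {Q : Finset (Finset ℕ)} :
    RootedNC 1 n B Q ↔ B ∉ Q ∧ 1 ∈ B ∧ insert B Q ∈ NCP n := by
  rw [mem_NCP]
  constructor
  · intro h
    refine ⟨h.root_notMem, h.root_mem, ⟨?_, ?_⟩, h.nonCrossing⟩
    · exact Finset.forall_mem_insert _ _ _ |>.2 ⟨⟨h.root_subset, 1, h.root_mem⟩,
        fun D hD => ⟨h.block_subset D hD, h.block_nonempty D hD⟩⟩
    · intro x hx
      apply existsUnique_of_exists_of_unique
      · rcases h.cover x hx with h1 | ⟨D, hD, h1⟩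
        · exact ⟨B, by simp, h1⟩
        · exact ⟨D, by simp [hD], h1⟩
      · rintro D D' ⟨hD, hx1⟩ ⟨hD', hx2⟩
        rcases Finset.mem_insert.1 hD with rfl | hDQ <;>
          rcases Finset.mem_insert.1 hD' with rfl | hDQ'
        · rfl
        · exact absurd hx1 (h.root_disjoint D' hDQ' x hx2)
        · exact absurd hx2 (h.root_disjoint D hDQ x hx1)
        · exact h.block_unique D hDQ D' hDQ' x hx1 hx2
  · rintro ⟨hBQ, h1, ⟨hP, hU⟩, hNC⟩
    have huniq : ∀ D ∈ insert B Q, ∀ D' ∈ insert B Q, ∀ x, x ∈ D → x ∈ D' → D = D' :=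
      fun D hD D' hD' x hx hx' => (hU x ((hP D hD).1 hx)).unique ⟨hD, hx⟩ ⟨hD', hx'⟩
    refine ⟨h1, (hP B (by simp)).1, fun D hD => (hP D (by simp [hD])).1,
      fun D hD => (hP D (by simp [hD])).2, fun D hD x hx hx' => hBQ ?_,
      fun D hD D' hD' => huniq D (by simp [hD]) D' (by simp [hD']), fun x hx => ?_, hNC⟩
    · rwa [huniq B (by simp) D (by simp [hD]) x hx' hx]
    · obtain ⟨D, ⟨hD, hxD⟩, -⟩ := hU x hx
      rcases Finset.mem_insert.1 hD with rfl | hD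
      · exact Or.inl hxD
      · exact Or.inr ⟨D, hD, hxD⟩

lemma RootedNC.blockOf_insert {a n : ℕ} {B : Finset ℕ} {Q : Finset (Finset ℕ)}
    (h : RootedNC a n B Q) :
    blockOf a (insert B Q) = B ∧ (insert B Q).filter (a ∉ ·) = Q := by
  have hQ : ∀ D ∈ Q, a ∉ D := fun D hD h' => h.root_disjoint D hD a h' h.root_mem
  constructor
  · rw [blockOf, Finset.filter_insert, if_pos h.root_mem, Finset.filter_false_of_mem hQ]
    simp
  · rw [Finset.filter_insert, if_neg (by simpa using h.root_mem), Finset.filter_true_of_mem hQ]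

lemma rootedNC_erase {n : ℕ} {P : Finset (Finset ℕ)} (hP : P ∈ NCP n) {B : Finset ℕ}
    (hB : B ∈ P) (h1 : 1 ∈ B) : RootedNC 1 n B (P.erase B) :=
  rootedNC_one_iff.2 ⟨Finset.notMem_erase B P, h1, by rwa [Finset.insert_erase hB]⟩

lemma blockOf_one_eq {n : ℕ} {P : Finset (Finset ℕ)} (hP : P ∈ NCP n) {B : Finset ℕ}
    (hB : B ∈ P) (h1 : 1 ∈ B) : blockOf 1 P = B ∧ P.filter (1 ∉ ·) = P.erase B := by
  have := (rootedNC_erase hP hB h1).blockOf_insert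
  rwa [Finset.insert_erase hB] at this

lemma sum_rootBlock_card (w : ℕ → ℝ) (hw0 : w 0 = 1) {n : ℕ} (hn : 1 ≤ n) (k : ℕ) :
    ∑ P ∈ (NCP n).filter (fun P => ∃ B ∈ P, 1 ∈ B ∧ B.card = k), OmegaP w P =
      w k * forest w n k := by
  obtain ⟨m, rfl⟩ : ∃ m, n = 1 + m := ⟨n - 1, by omega⟩
  rw [add_comm 1 m, ← rootedWeight_eq_forest w hw0 m 1 k, add_comm m 1, rootedWeight,
    Finset.mul_sum]
  symm
  refine Finset.sum_bij' (fun p _ => insert p.1 p.2)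
    (fun P _ => (blockOf 1 P, P.filter (1 ∉ ·))) ?_ ?_ ?_ ?_ ?_
  · rintro ⟨B, Q⟩ hp
    obtain ⟨hR, hc⟩ := mem_rootedNC.1 hp
    exact Finset.mem_filter.2 ⟨(rootedNC_one_iff.1 hR).2.2, B, by simp, hR.root_mem, hc⟩
  · intro P hP
    obtain ⟨hP, B, hB, h1, hc⟩ := Finset.mem_filter.1 hP
    obtain ⟨h2, h3⟩ := blockOf_one_eq hP hB h1
    rw [mem_rootedNC, h2, h3]
    exact ⟨rootedNC_erase hP hB h1, hc⟩
  · rintro ⟨B, Q⟩ hp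
    obtain ⟨hR, hc⟩ := mem_rootedNC.1 hp
    obtain ⟨h2, h3⟩ := hR.blockOf_insert
    simp only [h2, h3]
  · intro P hP
    obtain ⟨hP, B, hB, h1, hc⟩ := Finset.mem_filter.1 hP
    obtain ⟨h2, h3⟩ := blockOf_one_eq hP hB h1
    simp only [h2, h3, Finset.insert_erase hB]
  · rintro ⟨B, Q⟩ hp
    obtain ⟨hR, hc⟩ := mem_rootedNC.1 hp
    simp only at hR hc ⊢
    rw [OmegaP, OmegaP, Finset.prod_insert hR.root_notMem, hc]

lemma Zw_eq_forest (w : ℕ → ℝ) (hw0 : w 0 = 1) {n : ℕ} (hn : 1 ≤ n) :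
    Zw w n = forest w (n + 1) 1 := by
  have hblock : ∀ P ∈ NCP n, ∃ B ∈ P, 1 ∈ B := fun P hP => by
    obtain ⟨B, hB, -⟩ := (mem_NCP.1 hP).1.2 1 (Finset.mem_Icc.2 ⟨le_rfl, hn⟩)
    exact ⟨B, hB⟩
  have hmaps : ∀ P ∈ NCP n, (blockOf 1 P).card ∈ Finset.range (n + 1) := by
    intro P hP
    obtain ⟨B, hB, h1⟩ := hblock P hP
    have := Finset.card_le_card (rootedNC_erase hP hB h1).root_subset
    rw [Nat.card_Icc] at this
    rw [(blockOf_one_eq hP hB h1).1, Finset.mem_range]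
    omega
  rw [Zw, ← Finset.sum_fiberwise_of_maps_to hmaps, forest]
  refine Finset.sum_congr rfl fun k _ => ?_
  rw [zero_add, ← sum_rootBlock_card w hw0 hn k]
  refine Finset.sum_congr (Finset.filter_congr fun P hP => ?_) fun _ _ => rfl
  constructor
  · intro hc
    obtain ⟨B, hB, h1⟩ := hblock P hP
    exact ⟨B, hB, h1, by rw [← hc, (blockOf_one_eq hP hB h1).1]⟩
  · rintro ⟨B, hB, h1, hc⟩
    rw [(blockOf_one_eq hP hB h1).1, hc]
open Finset.HasAntidiagonal (antidiagonal mem_antidiagonal)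

open PowerSeries in
/-- Coefficients of powers of the generating series of `w`. -/
noncomputable def powCoeff (w : ℕ → ℝ) (m n : ℕ) : ℝ :=
  coeff n ((mk w) ^ m)

lemma forest_eq_zero (w : ℕ → ℝ) : ∀ {n h : ℕ}, n < h → forest w n h = 0
  | 0, h, hh => by rw [forest, if_neg (by omega)]
  | n + 1, 0, hh => by omega
  | n + 1, h + 1, hh => by
    rw [forest]
    exact Finset.sum_eq_zero fun j _ => by rw [forest_eq_zero w (by omega), mul_zero]

lemma forest_nonneg {w : ℕ → ℝ} (hw : ∀ i, 0 ≤ w i) : ∀ n h : ℕ, 0 ≤ forest w n h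
  | 0, h => by rw [forest]; split_ifs <;> norm_num
  | n + 1, 0 => by rw [forest]
  | n + 1, h + 1 => by
    rw [forest]
    exact Finset.sum_nonneg fun j _ => mul_nonneg (hw j) (forest_nonneg hw n _)

lemma forest_zero (w : ℕ → ℝ) (n : ℕ) : forest w n 0 = if n = 0 then 1 else 0 := by
  cases n <;> simp [forest]

open PowerSeries in
/-- The derivative of a power: the cycle lemma in generating function form. -/
lemma sum_mul_powCoeff (w : ℕ → ℝ) (m n : ℕ) :
    (m + 1) * ∑ p ∈ antidiagonal n, (p.1 : ℝ) * w p.1 * powCoeff w m p.2 =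
      n * powCoeff w (m + 1) n := by
  rcases n with _ | n
  · simp
  have h1 := congrArg (coeff n) (Derivation.leibniz_pow (derivative ℝ) (a := (mk w : ℝ⟦X⟧)) (m + 1))
  rw [Finset.Nat.sum_antidiagonal_succ]
  rw [show powCoeff w (m + 1) (n + 1) = coeff (n + 1) ((mk w : ℝ⟦X⟧) ^ (m + 1)) from rfl]
  have h2 : coeff n ((derivative ℝ) ((mk w : ℝ⟦X⟧) ^ (m + 1))) =
    coeff (n + 1) ((mk w : ℝ⟦X⟧) ^ (m + 1)) * (n + 1) := coeff_derivative _ _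
  have h3 : coeff n ((mk w : ℝ⟦X⟧) ^ m * (derivative ℝ) (mk w)) =
    ∑ p ∈ antidiagonal n, ((p.1 + 1 : ℕ) : ℝ) * w (p.1 + 1) * powCoeff w m p.2 := by
    rw [mul_comm, coeff_mul]
    refine Finset.sum_congr rfl fun p _ => ?_
    rw [coeff_derivative, coeff_mk, powCoeff]
    push_cast; ring
  rw [h2, map_nsmul, Nat.add_sub_cancel, smul_eq_mul, h3, nsmul_eq_mul] at h1
  push_cast at h1 ⊢
  rw [zero_mul, zero_mul, zero_add, ← h1]
  ring

/-- Lagrange inversion for forests. -/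
lemma mul_forest (w : ℕ → ℝ) (hw0 : w 0 = 1) : ∀ n h d : ℕ, n = d + h →
    (n : ℝ) * forest w n h = h * powCoeff w n d := by
  intro n
  induction n with
  | zero =>
    intro h d hd
    obtain rfl : h = 0 := by omega
    simp
  | succ n ih =>
    intro h d hd
    rcases h with _ | h
    · simp [forest]
    rcases n with _ | n
    · obtain ⟨rfl, rfl⟩ : h = 0 ∧ d = 0 := by omega
      simp [forest, powCoeff, hw0]
    have hdn : n + 1 = d + h := by omega
    have h1 : ((n + 1 : ℕ) : ℝ) * forest w (n + 1 + 1) (h + 1) =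
        ∑ p ∈ antidiagonal d, w p.1 * ((h + p.1 : ℕ) * powCoeff w (n + 1) p.2) := by
      rw [forest, Finset.Nat.sum_antidiagonal_eq_sum_range_succ_mk, Finset.mul_sum]
      rw [← Finset.sum_subset (s₁ := Finset.range (d + 1))]
      · refine Finset.sum_congr rfl fun j hj => ?_
        rw [Finset.mem_range] at hj
        rw [← ih (h + j) (d - j) (by omega)]
        ring
      · exact Finset.range_subset_range.2 (by omega)
      · intro j _ hj
        rw [Finset.mem_range] at hj
        rw [forest_eq_zero w (by omega)]; simp
    have h2 : powCoeff w (n + 1 + 1) d =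
        ∑ p ∈ antidiagonal d, w p.1 * powCoeff w (n + 1) p.2 := by
      rw [powCoeff, pow_succ', PowerSeries.coeff_mul]
      simp [powCoeff]
    have h3 := sum_mul_powCoeff w (n + 1) d
    have h4 : ∑ p ∈ antidiagonal d, w p.1 * ((h + p.1 : ℕ) * powCoeff w (n + 1) p.2) =
        h * powCoeff w (n + 1 + 1) d +
        ∑ p ∈ antidiagonal d, (p.1 : ℝ) * w p.1 * powCoeff w (n + 1) p.2 := by
      rw [h2, Finset.mul_sum, ← Finset.sum_add_distrib]
      refine Finset.sum_congr rfl fun p _ => ?_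
      push_cast; ring
    rw [h4] at h1
    have h5 : (d : ℝ) = n + 1 - h := by
      have : ((n + 1 : ℕ) : ℝ) = d + h := by rw [hdn]; push_cast; ring
      push_cast at this; linarith
    rw [h5] at h3
    have hn : (n : ℝ) + 1 ≠ 0 := by positivity
    apply mul_left_cancel₀ hn
    push_cast at *
    linear_combination (n + 1 + 1 : ℝ) * h1 + h3

lemma sum_forest_mul_forest (w : ℕ → ℝ) (n : ℕ) : ∀ a b : ℕ,
    ∑ p ∈ antidiagonal n, forest w p.1 a * forest w p.2 b = forest w n (a + b) := by
  induction n with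
  | zero => 
    intro a b
    simp only [Finset.Nat.antidiagonal_zero, Finset.sum_singleton, forest]
    rcases a with _ | a <;> rcases b with _ | b <;> simp
  | succ n ih =>
    intro a b
    rw [Finset.Nat.sum_antidiagonal_succ]
    rcases a with _ | a
    · simp [forest]
    · simp only [forest]
      have hext : ∀ m ≤ n, ∀ c, ∑ j ∈ Finset.range (m + 1), w j * forest w m (c + j) =
          ∑ j ∈ Finset.range (n + 1), w j * forest w m (c + j) := by
        intro m hm c
        apply Finset.sum_subset (Finset.range_subset_range.2 (by omega))
        intro j _ hj
        rw [Finset.mem_range] at hj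
        rw [forest_eq_zero w (by omega), mul_zero]
      have : ∀ p ∈ antidiagonal n,
          forest w (p.1 + 1) (a + 1) * forest w p.2 b =
          ∑ j ∈ Finset.range (n + 1), w j * (forest w p.1 (a + j) * forest w p.2 b) := by
        intro p hp
        have := mem_antidiagonal.1 hp
        rw [forest, hext _ (by omega), Finset.sum_mul]
        exact Finset.sum_congr rfl fun j _ => by ring
      rw [if_neg (by omega), zero_mul, zero_add, show a + 1 + b = (a + b) + 1 by ring, forest]
      refine (Finset.sum_congr rfl this).trans ?_
      rw [Finset.sum_comm]
      refine Finset.sum_congr rfl fun j _ => ?_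
      rw [← Finset.mul_sum, ih, show a + j + b = a + b + j by ring]

open PowerSeries in
lemma coeff_pow_forest (w : ℕ → ℝ) (n h : ℕ) :
    coeff n ((mk fun i => forest w i 1) ^ h) = forest w n h := by
  induction h generalizing n with
  | zero => rw [pow_zero, coeff_one, forest_zero]
  | succ h ih =>
    rw [pow_succ, coeff_mul, ← sum_forest_mul_forest]
    simp [ih]

open PowerSeries in
lemma coeff_pow_nonneg {f : ℝ⟦X⟧} (hf : ∀ i, 0 ≤ coeff i f) (m n : ℕ) :
    0 ≤ coeff n (f ^ m) := by
  induction m generalizing n with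
  | zero => rw [pow_zero, coeff_one]; split_ifs <;> norm_num
  | succ m ih =>
    rw [pow_succ, coeff_mul]
    exact Finset.sum_nonneg fun p _ => mul_nonneg (ih _) (hf _)

open PowerSeries in
lemma hasSum_coeff_pow {f : ℝ⟦X⟧} (hf : ∀ i, 0 ≤ coeff i f) {x F : ℝ} (hx : 0 ≤ x)
    (h : HasSum (fun n => coeff n f * x ^ n) F) (m : ℕ) :
    HasSum (fun n => coeff n (f ^ m) * x ^ n) (F ^ m) := by
  induction m with
  | zero =>
    rw [pow_zero, pow_zero]
    convert hasSum_single 0 ?_ using 1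
    · simp
    · intro n hn; simp [coeff_one, hn]
  | succ m ih =>
    have hn1 : Summable fun n => ‖coeff n (f ^ m) * x ^ n‖ := by
      refine ih.summable.congr fun n => ?_
      rw [Real.norm_of_nonneg (mul_nonneg (coeff_pow_nonneg hf m n) (pow_nonneg hx n))]
    have hn2 : Summable fun n => ‖coeff n f * x ^ n‖ := by
      refine h.summable.congr fun n => ?_
      rw [Real.norm_of_nonneg (mul_nonneg (hf n) (pow_nonneg hx n))]
    have h1 := (summable_norm_sum_mul_antidiagonal_of_summable_norm hn1 hn2).of_norm.hasSum
    rw [← tsum_mul_tsum_eq_tsum_sum_antidiagonal_of_summable_norm hn1 hn2, ih.tsum_eq,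
      h.tsum_eq, ← pow_succ] at h1
    have he : ∀ n, coeff n (f ^ (m + 1)) * x ^ n = ∑ p ∈ antidiagonal n,
        coeff p.1 (f ^ m) * x ^ p.1 * (coeff p.2 f * x ^ p.2) := by
      intro n
      rw [pow_succ, coeff_mul, Finset.sum_mul]
      refine Finset.sum_congr rfl fun p hp => ?_
      rw [← mem_antidiagonal.1 hp, pow_add]
      ring
    simpa only [he] using h1
section PowCoeff

open PowerSeries

variable {w : ℕ → ℝ}

lemma powCoeff_nonneg (hw : ∀ i, 0 ≤ w i) (m n : ℕ) : 0 ≤ powCoeff w m n :=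
  coeff_pow_nonneg (by simpa using hw) m n

lemma powCoeff_mul_le (hw : ∀ i, 0 ≤ w i) (m n m' n' : ℕ) :
    powCoeff w m n * powCoeff w m' n' ≤ powCoeff w (m + m') (n + n') := by
  rw [powCoeff, powCoeff, powCoeff, pow_add, coeff_mul]
  exact Finset.single_le_sum (f := fun p : ℕ × ℕ => coeff p.1 (mk w ^ m) * coeff p.2 (mk w ^ m'))
    (fun p _ => mul_nonneg (powCoeff_nonneg hw m _) (powCoeff_nonneg hw m' _))
    (mem_antidiagonal.2 rfl : (n, n') ∈ antidiagonal (n + n'))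

lemma powCoeff_pow_le (hw : ∀ i, 0 ≤ w i) (m n q : ℕ) :
    powCoeff w m n ^ q ≤ powCoeff w (m * q) (n * q) := by
  induction q with
  | zero => simp [powCoeff]
  | succ q ih =>
    calc _ = powCoeff w m n ^ q * powCoeff w m n := pow_succ _ _
      _ ≤ powCoeff w (m * q) (n * q) * powCoeff w m n :=
        mul_le_mul_of_nonneg_right ih (powCoeff_nonneg hw _ _)
      _ ≤ _ := powCoeff_mul_le hw _ _ _ _

lemma pow_le_powCoeff (hw : ∀ i, 0 ≤ w i) (k q : ℕ) : w k ^ q ≤ powCoeff w q (k * q) := by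
  simpa [powCoeff] using powCoeff_pow_le hw 1 k q

lemma powCoeff_mono (hw : ∀ i, 0 ≤ w i) (hw0 : w 0 = 1) (m r n : ℕ) :
    powCoeff w m n ≤ powCoeff w (m + r) n := by
  have h1 := pow_le_powCoeff hw 0 r
  rw [hw0, one_pow, zero_mul] at h1
  calc _ = powCoeff w m n * 1 := (mul_one _).symm
    _ ≤ powCoeff w m n * powCoeff w r 0 := mul_le_mul_of_nonneg_left h1 (powCoeff_nonneg hw _ _)
    _ ≤ _ := powCoeff_mul_le hw _ _ _ _

lemma powCoeff_succ_eq (hw0 : w 0 = 1) (n : ℕ) :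
    powCoeff w (n + 1) n = (n + 1) * forest w (n + 1) 1 := by
  have := mul_forest w hw0 (n + 1) 1 n rfl
  push_cast at this
  linarith

lemma powCoeff_mul_pow_le (hw : ∀ i, 0 ≤ w i) {x F : ℝ} (hx : 0 ≤ x)
    (h : HasSum (fun n => w n * x ^ n) F) (m n : ℕ) : powCoeff w m n * x ^ n ≤ F ^ m := by
  have h1 := hasSum_coeff_pow (f := mk w) (by simpa using hw) hx (by simpa using h) m
  exact le_hasSum h1 n fun i _ => mul_nonneg (powCoeff_nonneg hw m i) (pow_nonneg hx i)

/-- If the diagonal coefficients grow at most like `β ^ n`, the tree series converges below `1 / β`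
and solves its functional equation there. -/
lemma exists_tsum_le (hw : ∀ i, 0 ≤ w i) (hw0 : w 0 = 1) {K : ℕ} (hK : 2 ≤ K) (hwK : 0 < w K)
    {β x : ℝ} (hβ : 0 < β) (hx : 0 < x) (hxβ : x * β < 1) (hle : ∀ n, powCoeff w n n ≤ β ^ n) :
    ∃ t, 0 < t ∧ Summable (fun j => w j * t ^ j) ∧ ∑' j, w j * t ^ j ≤ t / x := by
  have hbound : ∀ n, forest w (n + 1) 1 ≤ β ^ (n + K) / w K := by
    intro n
    have h1 := powCoeff_mul_le hw (n + 1) n 1 K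
    have h2 := powCoeff_mono hw hw0 (n + 1 + 1) (K - 2) (n + K)
    rw [show n + 1 + 1 + (K - 2) = n + K by omega] at h2
    have h3 : powCoeff w 1 K = w K := by simp [powCoeff]
    rw [h3] at h1
    rw [le_div_iff₀ hwK]
    refine le_trans (mul_le_mul_of_nonneg_right ?_ hwK.le) ((h1.trans h2).trans (hle _))
    rw [powCoeff_succ_eq hw0]
    have := forest_nonneg hw (n + 1) 1
    nlinarith [(Nat.cast_nonneg n : (0 : ℝ) ≤ n)]
  have hsum' : Summable fun n => forest w (n + 1) 1 * x ^ (n + 1) := by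
    have hg : Summable fun n : ℕ => (β ^ K / w K * x) * (x * β) ^ n :=
      (summable_geometric_of_lt_one (by positivity) hxβ).mul_left _
    refine Summable.of_nonneg_of_le
      (fun n => mul_nonneg (forest_nonneg hw _ _) (by positivity)) (fun n => ?_) hg
    calc _ ≤ β ^ (n + K) / w K * x ^ (n + 1) :=
          mul_le_mul_of_nonneg_right (hbound n) (by positivity)
      _ = _ := by rw [pow_add, pow_add, mul_pow]; ring
  have hsum : Summable fun n => forest w n 1 * x ^ n :=
    (summable_nat_add_iff (f := fun n => forest w n 1 * x ^ n) 1).1 hsum'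
  set t := ∑' n, forest w n 1 * x ^ n with ht
  have hpow : ∀ h, HasSum (fun n => forest w n h * x ^ n) (t ^ h) := by
    intro h
    have := hasSum_coeff_pow (f := mk fun i => forest w i 1)
      (by simpa using fun i => forest_nonneg hw i 1) hx.le (by simpa using hsum.hasSum) h
    simpa only [coeff_pow_forest] using this
  have hshift : HasSum (fun n => forest w (n + 1) 1 * x ^ n) (t / x) := by
    have h1 : t = ∑' n, forest w (n + 1) 1 * x ^ (n + 1) := by
      rw [ht, hsum.tsum_eq_zero_add]
      simp [forest]
    have h2 := hsum'.hasSum.div_const x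
    rw [← h1] at h2
    have h3 : ∀ n, forest w (n + 1) 1 * x ^ (n + 1) / x = forest w (n + 1) 1 * x ^ n := by
      intro n
      rw [pow_succ]
      field_simp
    simpa only [h3] using h2
  have ht0 : 0 < t := by
    have h1 := le_hasSum hsum.hasSum 1 fun i _ =>
      mul_nonneg (forest_nonneg hw i 1) (pow_nonneg hx.le i)
    rw [← ht] at h1
    simp [forest, hw0] at h1
    linarith
  have hpartial : ∀ J, ∑ j ∈ Finset.range J, w j * t ^ j ≤ t / x := by
    intro J
    have h1 : HasSum (fun n => ∑ j ∈ Finset.range J, w j * (forest w n j * x ^ n))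
        (∑ j ∈ Finset.range J, w j * t ^ j) := hasSum_sum fun j _ => (hpow j).mul_left _
    refine hasSum_le (fun n => ?_) h1 hshift
    have h2 : ∑ j ∈ Finset.range J, w j * (forest w n j * x ^ n) =
        (∑ j ∈ Finset.range J, w j * forest w n j) * x ^ n := by
      rw [Finset.sum_mul]
      exact Finset.sum_congr rfl fun j _ => by ring
    rw [h2, forest]
    refine mul_le_mul_of_nonneg_right ?_ (by positivity)
    have h3 : ∑ j ∈ Finset.range J, w j * forest w n j ≤
        ∑ j ∈ Finset.range (J + (n + 1)), w j * forest w n j :=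
      Finset.sum_le_sum_of_subset_of_nonneg (Finset.range_subset_range.2 (by omega))
        fun j _ _ => mul_nonneg (hw j) (forest_nonneg hw n j)
    refine h3.trans (le_of_eq ?_)
    symm
    simp only [zero_add]
    apply Finset.sum_subset (Finset.range_subset_range.2 (by omega))
    intro j _ hj
    rw [Finset.mem_range] at hj
    rw [forest_eq_zero w (by omega), mul_zero]
  have hnn : ∀ j, 0 ≤ w j * t ^ j := fun j => mul_nonneg (hw j) (pow_nonneg ht0.le j)
  exact ⟨t, ht0, summable_of_sum_range_le hnn hpartial,
    Real.tsum_le_of_sum_range_le hnn hpartial⟩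

/-- Supermultiplicativity turns one large diagonal coefficient into a lower bound along all
admissible indices. -/
lemma exists_const_mul_pow_le (hw : ∀ i, 0 ≤ w i) {β : ℝ} (hβ : 0 < β) {N : ℕ} (hN : 0 < N)
    (hle : β ^ N ≤ powCoeff w N N) :
    ∃ c, 0 < c ∧ ∀ n, 0 < powCoeff w (n + 1) n → c * β ^ n ≤ powCoeff w (n + 1) n := by
  have hres : ∀ r, ∃ c, 0 < c ∧ ∀ n, n % N = r → 0 < powCoeff w (n + 1) n →
      c * β ^ n ≤ powCoeff w (n + 1) n := by
    intro r
    by_cases hex : ∃ n, n % N = r ∧ 0 < powCoeff w (n + 1) n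
    · set n₀ := Nat.find hex with hn₀
      obtain ⟨hr, hpos⟩ := Nat.find_spec hex
      rw [← hn₀] at hr hpos
      refine ⟨powCoeff w (n₀ + 1) n₀ / β ^ n₀, by positivity, fun n hn hnpos => ?_⟩
      have hmin : n₀ ≤ n := Nat.find_min' hex ⟨hn, hnpos⟩
      obtain ⟨q, hq⟩ : ∃ q, n = n₀ + N * q := by
        have h1 : N ∣ n - n₀ := (Nat.modEq_iff_dvd' hmin).1 (hr.trans hn.symm)
        obtain ⟨q, hq⟩ := h1
        exact ⟨q, by omega⟩
      have h1 := powCoeff_mul_le hw (n₀ + 1) n₀ (N * q) (N * q)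
      have h2 := (pow_le_pow_left₀ (by positivity) hle q).trans (powCoeff_pow_le hw N N q)
      rw [hq]
      calc _ = powCoeff w (n₀ + 1) n₀ * (β ^ N) ^ q := by
            rw [pow_add, pow_mul]; field_simp
        _ ≤ powCoeff w (n₀ + 1) n₀ * powCoeff w (N * q) (N * q) :=
            mul_le_mul_of_nonneg_left h2 hpos.le
        _ ≤ _ := by rw [show n₀ + N * q + 1 = n₀ + 1 + N * q by ring]; exact h1
    · exact ⟨1, one_pos, fun n hn hpos => absurd ⟨n, hn, hpos⟩ hex⟩
  choose c hc hcle using hres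
  have hne : (Finset.range N).Nonempty := ⟨0, Finset.mem_range.2 hN⟩
  refine ⟨(Finset.range N).inf' hne c, (Finset.lt_inf'_iff hne).2 fun r _ => hc r,
    fun n hn => ?_⟩
  refine le_trans (mul_le_mul_of_nonneg_right ?_ (by positivity)) (hcle (n % N) n rfl hn)
  exact Finset.inf'_le c (Finset.mem_range.2 (Nat.mod_lt n hN))

/-- Contribution to `powCoeff w m n` of the words in which the letter `k` occurs exactly `j` times,
with the weight of `k` factored out. -/
noncomputable def letterCoeff (w : ℕ → ℝ) (k m n j : ℕ) : ℝ :=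
  m.choose j * coeff n ((X : ℝ⟦X⟧) ^ (k * j) * (mk (Function.update w k 0)) ^ (m - j))

lemma letterCoeff_nonneg (hw : ∀ i, 0 ≤ w i) (k m n j : ℕ) : 0 ≤ letterCoeff w k m n j := by
  refine mul_nonneg (Nat.cast_nonneg _) ?_
  rw [coeff_X_pow_mul']
  split_ifs
  · refine coeff_pow_nonneg (fun i => ?_) _ _
    rw [coeff_mk, Function.update_apply]
    split_ifs
    exacts [le_rfl, hw i]
  · exact le_rfl

lemma mk_update_eq (w : ℕ → ℝ) (k : ℕ) (v : ℝ) :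
    (mk (Function.update w k v) : ℝ⟦X⟧) = C v * X ^ k + mk (Function.update w k 0) := by
  ext i
  rw [map_add, coeff_C_mul, coeff_X_pow, coeff_mk, coeff_mk, Function.update_apply,
    Function.update_apply]
  split_ifs <;> simp

lemma powCoeff_update (w : ℕ → ℝ) (k : ℕ) (v : ℝ) (m n : ℕ) :
    powCoeff (Function.update w k v) m n =
      ∑ j ∈ Finset.range (m + 1), letterCoeff w k m n j * v ^ j := by
  rw [powCoeff, mk_update_eq, add_pow, map_sum]
  refine Finset.sum_congr rfl fun j _ => ?_
  rw [letterCoeff, mul_pow, ← map_pow, ← pow_mul]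
  have : (C (v ^ j) * X ^ (k * j) * mk (Function.update w k 0) ^ (m - j) *
      ((m.choose j : ℕ) : ℝ⟦X⟧)) = C ((m.choose j : ℝ) * v ^ j) *
      (X ^ (k * j) * mk (Function.update w k 0) ^ (m - j)) := by
    rw [map_mul, map_natCast]; ring
  rw [this, coeff_C_mul]
  ring

/-- Factorial moments of the number of occurrences of the letter `k`. -/
lemma sum_descFactorial_mul_letterCoeff (w : ℕ → ℝ) (k m n K : ℕ) :
    ∑ j ∈ Finset.range (m + K + 1),
        (j.descFactorial K : ℝ) * (letterCoeff w k (m + K) n j * w k ^ j) =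
      (m + K).descFactorial K * w k ^ K * coeff n ((X : ℝ⟦X⟧) ^ (k * K) * mk w ^ m) := by
  rw [show m + K + 1 = K + (m + 1) by ring, Finset.sum_range_add, Finset.sum_eq_zero, zero_add]
  swap
  · intro j hj
    rw [Nat.descFactorial_of_lt (Finset.mem_range.1 hj)]
    simp
  rw [coeff_X_pow_mul']
  split_ifs with hn
  · have h1 := powCoeff_update w k (w k) m (n - k * K)
    rw [Function.update_eq_self, powCoeff] at h1
    rw [h1, Finset.mul_sum]
    refine Finset.sum_congr rfl fun j hj => ?_
    have hjm : j ≤ m := by rw [Finset.mem_range] at hj; omega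
    have h2 : (m + K).choose (K + j) * (K + j).descFactorial K =
        (m + K).descFactorial K * m.choose j := by
      have h3 := Nat.choose_mul (n := m + K) (k := K + j) (s := K) (by omega)
      rw [Nat.descFactorial_eq_factorial_mul_choose, Nat.descFactorial_eq_factorial_mul_choose]
      rw [Nat.add_sub_cancel, Nat.add_sub_cancel_left] at h3
      calc _ = K.factorial * ((m + K).choose (K + j) * (K + j).choose K) := by ring
        _ = _ := by rw [h3]; ring
    have h2' : ((m + K).choose (K + j) : ℝ) * (K + j).descFactorial K =
        (m + K).descFactorial K * m.choose j := by exact_mod_cast h2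
    have h4 : coeff n ((X : ℝ⟦X⟧) ^ (k * (K + j)) *
        mk (Function.update w k 0) ^ (m + K - (K + j))) =
        coeff (n - k * K) ((X : ℝ⟦X⟧) ^ (k * j) * mk (Function.update w k 0) ^ (m - j)) := by
      rw [mul_add, pow_add, mul_assoc, coeff_X_pow_mul', if_pos hn]
      congr 3
      omega
    rw [letterCoeff, letterCoeff, h4, pow_add]
    linear_combination (coeff (n - k * K) ((X : ℝ⟦X⟧) ^ (k * j) *
      mk (Function.update w k 0) ^ (m - j)) * w k ^ K * w k ^ j) * h2'
  · rw [mul_zero]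
    refine Finset.sum_eq_zero fun j _ => ?_
    rw [letterCoeff, coeff_X_pow_mul', if_neg]
    · simp
    · have : k * (K + j) = k * K + k * j := by ring
      omega

/-- The expected number of letters `k` in a random word of length `m + 1` and weight `n`. -/
noncomputable def letterMean (w : ℕ → ℝ) (k m n : ℕ) : ℝ :=
  (m + 1) * w k * coeff n ((X : ℝ⟦X⟧) ^ k * mk w ^ m) / powCoeff w (m + 1) n

lemma powCoeff_eq_sum (w : ℕ → ℝ) (k m n : ℕ) :
    powCoeff w m n = ∑ j ∈ Finset.range (m + 1), letterCoeff w k m n j * w k ^ j := by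
  rw [← powCoeff_update, Function.update_eq_self]

lemma letterMean_eq (w : ℕ → ℝ) (k m n : ℕ) :
    letterMean w k m n = ∑ j ∈ Finset.range (m + 1 + 1),
      letterCoeff w k (m + 1) n j * w k ^ j / powCoeff w (m + 1) n * (j : ℝ) := by
  have := sum_descFactorial_mul_letterCoeff w k m n 1
  simp only [Nat.descFactorial_one, pow_one, mul_one] at this
  rw [letterMean]
  push_cast at this
  rw [← this, Finset.sum_div]
  exact Finset.sum_congr rfl fun j _ => by ring

lemma letterMean_nonneg (hw : ∀ i, 0 ≤ w i) (k m n : ℕ) : 0 ≤ letterMean w k m n := by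
  rw [letterMean_eq]
  exact Finset.sum_nonneg fun j _ => mul_nonneg (div_nonneg (mul_nonneg
    (letterCoeff_nonneg hw _ _ _ _) (pow_nonneg (hw k) j)) (powCoeff_nonneg hw _ _))
    (Nat.cast_nonneg j)

/-- Jensen's inequality for the number of letters `k`. -/
lemma exp_mul_powCoeff_le (hw : ∀ i, 0 ≤ w i) (k m n : ℕ) (hpos : 0 < powCoeff w (m + 1) n)
    (s : ℝ) : Real.exp (s * letterMean w k m n) * powCoeff w (m + 1) n ≤
      powCoeff (Function.update w k (w k * Real.exp s)) (m + 1) n := by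
  have hJ := convexOn_exp.map_sum_le (t := Finset.range (m + 1 + 1))
    (w := fun j => letterCoeff w k (m + 1) n j * w k ^ j / powCoeff w (m + 1) n)
    (p := fun j => s * j)
    (fun j _ => div_nonneg (mul_nonneg (letterCoeff_nonneg hw _ _ _ _) (pow_nonneg (hw k) j))
      hpos.le)
    (by rw [← Finset.sum_div, ← powCoeff_eq_sum, div_self hpos.ne']) (fun _ _ => Set.mem_univ _)
  have h1 : ∑ j ∈ Finset.range (m + 1 + 1),
      (letterCoeff w k (m + 1) n j * w k ^ j / powCoeff w (m + 1) n) • (s * (j : ℝ)) =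
      s * letterMean w k m n := by
    rw [letterMean_eq, Finset.mul_sum]
    exact Finset.sum_congr rfl fun j _ => by rw [smul_eq_mul]; ring
  rw [h1] at hJ
  rw [← le_div_iff₀ hpos, powCoeff_update, Finset.sum_div]
  refine hJ.trans (le_of_eq (Finset.sum_congr rfl fun j _ => ?_))
  rw [smul_eq_mul, mul_pow, ← Real.exp_nat_mul, mul_comm (j : ℝ) s]
  ring

end PowCoeff
lemma le_inv_wLimsup {w : ℕ → ℝ} (hw : ∀ i, 0 ≤ w i) {t : ℝ} (ht : 0 < t)
    (hs : Summable fun j => w j * t ^ j) : ENNReal.ofReal t ≤ (wLimsup w)⁻¹ := by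
  rw [ENNReal.le_inv_iff_le_inv, ← ENNReal.ofReal_inv_of_pos ht]
  refine Filter.limsup_le_of_le (by isBoundedDefault) ?_
  filter_upwards [hs.tendsto_atTop_zero.eventually_le_const one_pos,
    Filter.eventually_ge_atTop 1] with j hj hj1
  refine ENNReal.ofReal_le_ofReal ?_
  have h1 : w j ≤ t⁻¹ ^ j := by
    rw [inv_pow, ← one_div, le_div_iff₀ (by positivity)]
    exact hj
  calc w j ^ (1 / (j : ℝ)) ≤ (t⁻¹ ^ j) ^ (1 / (j : ℝ)) :=
        Real.rpow_le_rpow (hw j) h1 (by positivity)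
    _ = t⁻¹ := by
        rw [one_div, Real.pow_rpow_inv_natCast (by positivity) (by omega)]

/-- `ξ` minimises `Φ(t) / t`. -/
lemma tsum_mul_le_of_critical {w : ℕ → ℝ} (hw : ∀ i, 0 ≤ w i) {ξ t : ℝ} (hξ : 0 < ξ) (ht : 0 < t)
    (hs1 : Summable fun j : ℕ => (j : ℝ) * w j * ξ ^ j) (hs0 : Summable fun j => w j * ξ ^ j)
    (hst : Summable fun j => w j * t ^ j)
    (hcrit : ∑' j : ℕ, (j : ℝ) * w j * ξ ^ j = ∑' j : ℕ, w j * ξ ^ j ∨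
      (t ≤ ξ ∧ ∑' j : ℕ, (j : ℝ) * w j * ξ ^ j ≤ ∑' j : ℕ, w j * ξ ^ j)) :
    (∑' j, w j * ξ ^ j) * t ≤ (∑' j, w j * t ^ j) * ξ := by
  have h1 : ∑' j : ℕ, w j * ξ ^ j + (t / ξ - 1) * ∑' j : ℕ, (j : ℝ) * w j * ξ ^ j ≤
      ∑' j, w j * t ^ j := by
    refine hasSum_le (fun j => ?_) (hs0.hasSum.add (hs1.hasSum.mul_left (t / ξ - 1))) hst.hasSum
    have h2 := one_add_mul_le_pow (a := t / ξ - 1)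
      (by have : 0 < t / ξ := by positivity
          linarith) j
    rw [add_sub_cancel, div_pow, le_div_iff₀ (by positivity)] at h2
    nlinarith [mul_le_mul_of_nonneg_left h2 (hw j)]
  have h3 : (t / ξ - 1) * ∑' j : ℕ, w j * ξ ^ j ≤
      (t / ξ - 1) * ∑' j : ℕ, (j : ℝ) * w j * ξ ^ j := by
    rcases hcrit with h | ⟨hle, h⟩
    · rw [h]
    · refine mul_le_mul_of_nonpos_left h ?_
      rw [sub_nonpos, div_le_one hξ]
      exact hle
  have h4 : (∑' j, w j * ξ ^ j) * (t / ξ) ≤ ∑' j, w j * t ^ j := by linarith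
  rw [← mul_div_assoc, div_le_iff₀ hξ] at h4
  exact h4

/-- Exponential lower bound at any rate below `Φ(ξ) / ξ`. -/
lemma exists_lower_bound {w : ℕ → ℝ} (hw : ∀ i, 0 ≤ w i) (hw0 : w 0 = 1)
    (hw2 : ∃ k, 2 ≤ k ∧ 0 < w k) {ξ : ℝ} (hξ : 0 < ξ)
    (hmin : ∀ t, 0 < t → Summable (fun j => w j * t ^ j) →
      (∑' j, w j * ξ ^ j) * t ≤ (∑' j, w j * t ^ j) * ξ)
    {β : ℝ} (hβ : 0 < β) (hβξ : β < (∑' j, w j * ξ ^ j) / ξ) :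
    ∃ c, 0 < c ∧ ∀ n, 0 < powCoeff w (n + 1) n → c * β ^ n ≤ powCoeff w (n + 1) n := by
  suffices h : ∃ N, 0 < N ∧ β ^ N ≤ powCoeff w N N by
    obtain ⟨N, hN, hle⟩ := h
    exact exists_const_mul_pow_le hw hβ hN hle
  by_contra! hcon
  obtain ⟨K, hK, hwK⟩ := hw2
  obtain ⟨y, hy1, hy2⟩ := exists_between hβξ
  have hy : 0 < y := hβ.trans hy1
  obtain ⟨t, ht, hst, hle⟩ := exists_tsum_le (x := y⁻¹) hw hw0 hK hwK hβ (by positivity)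
    (by rw [inv_mul_lt_iff₀ hy]; linarith) fun n => by
      rcases Nat.eq_zero_or_pos n with rfl | hn
      · simp [powCoeff]
      · exact (hcon n hn).le
  have h1 := hmin t ht hst
  rw [div_inv_eq_mul] at hle
  rw [lt_div_iff₀ hξ] at hy2
  nlinarith [mul_le_mul_of_nonneg_right hle hξ.le, mul_lt_mul_of_pos_right hy2 ht]

/-- The filter of admissible indices tending to infinity. -/
abbrev admissible (w : ℕ → ℝ) : Filter ℕ :=
  Filter.atTop ⊓ Filter.principal {n | 0 < powCoeff w (n + 1) n}

lemma eventually_mul_letterMean_le {w : ℕ → ℝ} (hw : ∀ i, 0 ≤ w i) (hw0 : w 0 = 1)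
    (hw2 : ∃ k, 2 ≤ k ∧ 0 < w k) {ξ : ℝ} (hξ : 0 < ξ) (hs0 : Summable fun j => w j * ξ ^ j)
    (hmin : ∀ t, 0 < t → Summable (fun j => w j * t ^ j) →
      (∑' j, w j * ξ ^ j) * t ≤ (∑' j, w j * t ^ j) * ξ)
    (k : ℕ) {s : ℝ} (hs : s ≠ 0) (hs1 : |s| ≤ 1) :
    ∀ᶠ n in admissible w, s * (letterMean w k n n / n) ≤
      (s + s ^ 2) * (w k * ξ ^ k / ∑' j, w j * ξ ^ j) + 2 * s ^ 2 := by
  set F := ∑' j, w j * ξ ^ j with hF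
  have hF0 : 0 < F := by
    have := hs0.le_tsum 0 fun j _ => mul_nonneg (hw j) (pow_nonneg hξ.le j)
    rw [hw0, pow_zero, mul_one] at this
    linarith
  set p := w k * ξ ^ k / F with hp
  have hp0 : 0 ≤ p := div_nonneg (mul_nonneg (hw k) (by positivity)) hF0.le
  have hs2 : 0 < s ^ 2 := by positivity
  obtain ⟨c, hc, hlow⟩ := exists_lower_bound hw hw0 hw2 hξ hmin
    (β := F / ξ * Real.exp (-s ^ 2)) (by positivity)
    (mul_lt_of_lt_one_right (by positivity) (Real.exp_lt_one_iff.2 (by linarith)))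
  set a := (s + s ^ 2) * p with ha
  have hconst : ∀ᶠ n : ℕ in Filter.atTop, (Real.log (F / c) + a) / n ≤ s ^ 2 :=
    (tendsto_const_div_atTop_nhds_zero_nat _).eventually_le_const hs2
  have hupd : ∀ i, 0 ≤ Function.update w k (w k * Real.exp s) i := by
    intro i
    rw [Function.update_apply]
    split_ifs
    exacts [mul_nonneg (hw k) (Real.exp_nonneg s), hw i]
  have hFs : HasSum (fun j => Function.update w k (w k * Real.exp s) j * ξ ^ j)
      (F + (Real.exp s - 1) * (w k * ξ ^ k)) := by
    convert hs0.hasSum.add (hasSum_ite_eq k ((Real.exp s - 1) * (w k * ξ ^ k))) using 2 with j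
    rw [Function.update_apply]
    split_ifs with h
    · subst h; ring
    · ring
  have hFle : F + (Real.exp s - 1) * (w k * ξ ^ k) ≤ F * Real.exp a := by
    have h1 : w k * ξ ^ k = F * p := by rw [hp]; field_simp
    have h2 := (abs_le.1 (Real.abs_exp_sub_one_sub_id_le hs1)).2
    have h3 : (Real.exp s - 1) * p ≤ a := mul_le_mul_of_nonneg_right (by linarith) hp0
    have h4 := Real.add_one_le_exp a
    rw [h1]
    nlinarith [mul_le_mul_of_nonneg_left (h3.trans (by linarith : a ≤ Real.exp a - 1)) hF0.le]
  have hF' : 0 ≤ F + (Real.exp s - 1) * (w k * ξ ^ k) :=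
    hFs.nonneg fun j => mul_nonneg (hupd j) (by positivity)
  rw [Filter.eventually_inf_principal]
  filter_upwards [hconst, Filter.eventually_ge_atTop 1] with n hn hn1 hpos
  have hn0 : (0 : ℝ) < n := by exact_mod_cast hn1
  set E := letterMean w k n n with hE
  have hmain : c * Real.exp (s * E - s ^ 2 * n) ≤ F * Real.exp (a * (n + 1)) := by
    have h1 := exp_mul_powCoeff_le hw k n n hpos s
    have h2 := powCoeff_mul_pow_le hupd hξ.le hFs (n + 1) n
    have h3 := pow_le_pow_left₀ hF' hFle (n + 1)
    have h4 := hlow n hpos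
    have h5 : c * (F / ξ * Real.exp (-s ^ 2)) ^ n * Real.exp (s * E) * ξ ^ n ≤
        (F * Real.exp a) ^ (n + 1) := by
      refine le_trans (mul_le_mul_of_nonneg_right ?_ (by positivity)) (h2.trans h3)
      refine le_trans ?_ h1
      rw [mul_comm (Real.exp _)]
      exact mul_le_mul_of_nonneg_right h4 (Real.exp_nonneg _)
    have h6 : c * (F / ξ * Real.exp (-s ^ 2)) ^ n * Real.exp (s * E) * ξ ^ n =
        F ^ n * (c * Real.exp (s * E - s ^ 2 * n)) := by
      rw [mul_pow, div_pow, ← Real.exp_nat_mul, sub_eq_add_neg, Real.exp_add,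
        show (n : ℝ) * -s ^ 2 = -(s ^ 2 * n) by ring]
      field_simp
    have h7 : (F * Real.exp a) ^ (n + 1) = F ^ n * (F * Real.exp (a * (n + 1))) := by
      rw [mul_pow, ← Real.exp_nat_mul, pow_succ, show ((n + 1 : ℕ) : ℝ) * a = a * (n + 1) by
        push_cast; ring]
      ring
    rw [h6, h7] at h5
    exact le_of_mul_le_mul_left h5 (by positivity)
  have hlog : s * E - s ^ 2 * n ≤ Real.log (F / c) + a * (n + 1) := by
    have h1 : Real.exp (s * E - s ^ 2 * n) ≤ Real.exp (Real.log (F / c) + a * (n + 1)) := by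
      rw [Real.exp_add, Real.exp_log (by positivity), div_mul_eq_mul_div, le_div_iff₀ hc]
      linarith
    exact Real.exp_le_exp.1 h1
  rw [div_le_iff₀ hn0] at hn
  rw [← mul_div_assoc, div_le_iff₀ hn0]
  nlinarith

lemma tendsto_letterMean_of_rate_pos {w : ℕ → ℝ} (hw : ∀ i, 0 ≤ w i) (hw0 : w 0 = 1)
    (hw2 : ∃ k, 2 ≤ k ∧ 0 < w k) {ξ : ℝ} (hξ : 0 < ξ) (hs0 : Summable fun j => w j * ξ ^ j)
    (hmin : ∀ t, 0 < t → Summable (fun j => w j * t ^ j) →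
      (∑' j, w j * ξ ^ j) * t ≤ (∑' j, w j * t ^ j) * ξ) (k : ℕ) :
    Filter.Tendsto (fun n : ℕ => letterMean w k n n / n) (admissible w)
      (nhds (w k * ξ ^ k / ∑' j, w j * ξ ^ j)) := by
  have hev := fun {s : ℝ} => eventually_mul_letterMean_le hw hw0 hw2 hξ hs0 hmin k (s := s)
  set p := w k * ξ ^ k / ∑' j, w j * ξ ^ j with hp
  have hp0 : 0 ≤ p := div_nonneg (mul_nonneg (hw k) (by positivity))
    (tsum_nonneg fun j => mul_nonneg (hw j) (by positivity))
  rw [Metric.tendsto_nhds]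
  intro ε hε
  obtain ⟨s, hs, hs1⟩ := exists_between (lt_min one_pos (div_pos hε (by linarith : 0 < p + 2)))
  obtain ⟨hs1, hs2⟩ := lt_min_iff.1 hs1
  rw [lt_div_iff₀ (by linarith)] at hs2
  filter_upwards [hev hs.ne' (by rw [abs_of_pos hs]; exact hs1.le),
    hev (neg_ne_zero.2 hs.ne') (by rw [abs_neg, abs_of_pos hs]; exact hs1.le)] with n h1 h2
  have h1' : letterMean w k n n / n - p ≤ s * (p + 2) := by
    refine le_of_mul_le_mul_left ?_ hs
    linarith
  have h2' : p - letterMean w k n n / n ≤ s * (p + 2) := by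
    refine le_of_mul_le_mul_left ?_ hs
    linarith
  rw [Real.dist_eq, abs_lt]
  constructor <;> linarith

lemma letterMean_le {w : ℕ → ℝ} (hw : ∀ i, 0 ≤ w i) (hw0 : w 0 = 1) {k K m n : ℕ} (hk : k ≤ K)
    {ε : ℝ} (hε : 0 < ε) (hwK : w k ^ K ≤ ε ^ K * w K ^ k)
    (hpos : 0 < powCoeff w (m + K) n) (hK : 0 < K) :
    letterMean w k (m + K - 1) n ≤ K + 2 * ((m + K) * ε) := by
  obtain ⟨L, rfl⟩ : ∃ L, K = L + 1 := ⟨K - 1, by omega⟩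
  set lam : ℝ := (m + (L + 1 : ℕ)) * ε with hlam
  have hlam0 : 0 < lam := by positivity
  rw [show m + (L + 1) - 1 = m + L by omega, letterMean_eq, show m + L + 1 = m + (L + 1) by ring]
  set q : ℕ → ℝ := fun j => letterCoeff w k (m + (L + 1)) n j * w k ^ j with hq
  set Z := powCoeff w (m + (L + 1)) n with hZ
  have hq0 : ∀ j, 0 ≤ q j := fun j =>
    mul_nonneg (letterCoeff_nonneg hw _ _ _ _) (pow_nonneg (hw k) j)
  have hqZ : Z = ∑ j ∈ Finset.range (m + (L + 1) + 1), q j := powCoeff_eq_sum w k _ n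
  have hpt : ∀ j : ℕ, (j : ℝ) ≤
      ((L + 1 : ℕ) : ℝ) + lam + lam * ((j.descFactorial (L + 1) : ℝ) / lam ^ (L + 1)) := by
    intro j
    set y : ℝ := ((j + 1 - (L + 1) : ℕ) : ℝ) with hy
    have h1 : (j : ℝ) ≤ (L + 1 : ℕ) + y := by
      rw [hy]; exact_mod_cast (by omega : j ≤ L + 1 + (j + 1 - (L + 1)))
    have h2 : y ^ (L + 1) ≤ j.descFactorial (L + 1) := by
      rw [hy]; exact_mod_cast Nat.pow_sub_le_descFactorial j (L + 1)
    have hy0 : 0 ≤ y := Nat.cast_nonneg _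
    have h3 : y ≤ lam + lam * (y ^ (L + 1) / lam ^ (L + 1)) := by
      rw [← div_pow]
      have h4 : y / lam ≤ 1 + (y / lam) ^ (L + 1) := by
        have hyl : 0 ≤ y / lam := by positivity
        rcases le_total (y / lam) 1 with h | h
        · have := pow_nonneg hyl (L + 1); linarith
        · have := le_self_pow₀ h (by omega : L + 1 ≠ 0); linarith
      rw [div_le_iff₀ hlam0] at h4
      linarith
    have h5 : lam * (y ^ (L + 1) / lam ^ (L + 1)) ≤
        lam * ((j.descFactorial (L + 1) : ℝ) / lam ^ (L + 1)) := by gcongr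
    linarith
  have hfac := sum_descFactorial_mul_letterCoeff w k m n (L + 1)
  have hmom : ∑ j ∈ Finset.range (m + (L + 1) + 1), (j.descFactorial (L + 1) : ℝ) * q j ≤
      lam ^ (L + 1) * Z := by
    rw [hq, hfac, PowerSeries.coeff_X_pow_mul']
    split_ifs with hn
    · have h1 : w (L + 1) ^ k * powCoeff w m (n - k * (L + 1)) ≤ Z := by
        have h2 := pow_le_powCoeff hw (L + 1) k
        have h3 := powCoeff_mul_le hw k ((L + 1) * k) m (n - k * (L + 1))
        have h4 := powCoeff_mono hw hw0 (k + m) (L + 1 - k) ((L + 1) * k + (n - k * (L + 1)))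
        rw [show k + m + (L + 1 - k) = m + (L + 1) by omega,
          show (L + 1) * k + (n - k * (L + 1)) = n by
            rw [mul_comm]; omega] at h4
        rw [show (L + 1) * k + (n - k * (L + 1)) = n by rw [mul_comm]; omega] at h3
        exact (mul_le_mul_of_nonneg_right h2 (powCoeff_nonneg hw _ _)).trans (h3.trans h4)
      have h5 : ((m + (L + 1)).descFactorial (L + 1) : ℝ) ≤ (m + (L + 1 : ℕ)) ^ (L + 1) := by
        exact_mod_cast Nat.descFactorial_le_pow (m + (L + 1)) (L + 1)
      have hc0 := powCoeff_nonneg hw m (n - k * (L + 1))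
      rw [powCoeff] at h1 hc0
      set d := PowerSeries.coeff (n - k * (L + 1)) (PowerSeries.mk w ^ m)
      calc _ ≤ (m + (L + 1 : ℕ)) ^ (L + 1) * (ε ^ (L + 1) * w (L + 1) ^ k) * d := by
            have := pow_nonneg (hw k) (L + 1)
            gcongr
        _ = lam ^ (L + 1) * (w (L + 1) ^ k * d) := by rw [hlam, mul_pow]; ring
        _ ≤ _ := by gcongr
    · rw [mul_zero]; positivity
  calc ∑ j ∈ Finset.range (m + (L + 1) + 1), q j / Z * (j : ℝ)
      ≤ ∑ j ∈ Finset.range (m + (L + 1) + 1), q j / Z *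
        (((L + 1 : ℕ) : ℝ) + lam + lam * ((j.descFactorial (L + 1) : ℝ) / lam ^ (L + 1))) :=
        Finset.sum_le_sum fun j _ =>
          mul_le_mul_of_nonneg_left (hpt j) (div_nonneg (hq0 j) hpos.le)
    _ = (((L + 1 : ℕ) : ℝ) + lam) * ((∑ j ∈ Finset.range (m + (L + 1) + 1), q j) / Z) +
        lam * ((∑ j ∈ Finset.range (m + (L + 1) + 1), (j.descFactorial (L + 1) : ℝ) * q j) /
          (lam ^ (L + 1) * Z)) := by
        rw [Finset.sum_div, Finset.sum_div, Finset.mul_sum, Finset.mul_sum,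
          ← Finset.sum_add_distrib]
        refine Finset.sum_congr rfl fun j _ => ?_
        field_simp
    _ ≤ (((L + 1 : ℕ) : ℝ) + lam) * 1 + lam * 1 := by
        rw [← hqZ, div_self hpos.ne']
        gcongr
        exact div_le_one_of_le₀ hmom (by positivity)
    _ = _ := by ring

lemma tendsto_letterMean_of_rate_zero {w : ℕ → ℝ} (hw : ∀ i, 0 ≤ w i) (hw0 : w 0 = 1)
    (htop : wLimsup w = ⊤) {k : ℕ} (hk : 1 ≤ k) :
    Filter.Tendsto (fun n : ℕ => letterMean w k n n / n) (admissible w) (nhds 0) := by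
  rw [Metric.tendsto_nhds]
  intro ε hε
  set δ := ε / 6 with hδ
  have hδ0 : 0 < δ := by positivity
  set M := max 1 (w k / δ) with hM
  have hM1 : 1 ≤ M := le_max_left _ _
  obtain ⟨K, hKM, hkK⟩ : ∃ K, ENNReal.ofReal M < ENNReal.ofReal (w K ^ (1 / (K : ℝ))) ∧ k ≤ K :=
    ((Filter.frequently_lt_of_lt_limsup (by isBoundedDefault)
      (show ENNReal.ofReal M < wLimsup w by rw [htop]; exact ENNReal.ofReal_lt_top)).and_eventually
      (Filter.eventually_ge_atTop k)).exists
  have hK : 0 < K := by omega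
  have hMK : M ^ K ≤ w K := by
    have h1 := (ENNReal.ofReal_lt_ofReal_iff_of_nonneg (by linarith)).1 hKM
    have h2 := pow_le_pow_left₀ (by linarith) h1.le K
    rwa [one_div, Real.rpow_inv_natCast_pow (hw K) (by omega)] at h2
  have hwK : w k ^ K ≤ δ ^ K * w K ^ k := by
    have h1 : (w k / δ) ^ K ≤ M ^ K :=
      pow_le_pow_left₀ (div_nonneg (hw k) hδ0.le) (le_max_right _ _) K
    have h2 : w K ≤ w K ^ k := le_self_pow₀ ((one_le_pow₀ hM1).trans hMK) (by omega)
    rw [div_pow, div_le_iff₀ (by positivity)] at h1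
    calc _ ≤ M ^ K * δ ^ K := h1
      _ ≤ w K ^ k * δ ^ K := by gcongr; exact hMK.trans h2
      _ = _ := mul_comm _ _
  have hconst : ∀ᶠ n : ℕ in Filter.atTop, (K : ℝ) / n ≤ δ :=
    (tendsto_const_div_atTop_nhds_zero_nat _).eventually_le_const hδ0
  rw [Filter.eventually_inf_principal]
  filter_upwards [hconst, Filter.eventually_ge_atTop (K + 1)] with n hn hnK hpos
  have hn1 : (1 : ℝ) ≤ n := by exact_mod_cast (by omega : 1 ≤ n)
  obtain ⟨m, hm⟩ : ∃ m, n + 1 = m + K := ⟨n + 1 - K, by omega⟩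
  have h1 := letterMean_le (m := m) (n := n) hw hw0 hkK hδ0 hwK (by rw [← hm]; exact hpos) hK
  rw [show m + K - 1 = n by omega] at h1
  have h2 : (m : ℝ) + K = n + 1 := by exact_mod_cast hm.symm
  rw [h2] at h1
  rw [div_le_iff₀ (by linarith)] at hn
  rw [Real.dist_eq, sub_zero, abs_of_nonneg (div_nonneg (letterMean_nonneg hw k n n) (by linarith)),
    div_lt_iff₀ (by linarith)]
  have h3 : ε = 6 * δ := by rw [hδ]; ring
  rw [h3]
  nlinarith

lemma tendsto_letterMean {w : ℕ → ℝ} (hw0 : w 0 = 1) (hw : ∀ i, 0 ≤ w i)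
    (hw2 : ∃ k, 2 ≤ k ∧ 0 < w k) {π : ℕ → ℝ} (hπ : PiSpec w π) {k : ℕ} (hk : 1 ≤ k) :
    Filter.Tendsto (fun n : ℕ => letterMean w k n n / n) (admissible w) (nhds (π k)) := by
  rcases hπ with ⟨htop, -, h0⟩ | ⟨-, ξ, hξ, -, hs1, hπk, hcrit⟩
  · rw [h0 k hk]
    exact tendsto_letterMean_of_rate_zero hw hw0 htop hk
  · have hs0 : Summable fun j => w j * ξ ^ j := by
      rw [← summable_nat_add_iff 1] at hs1 ⊢
      refine Summable.of_nonneg_of_le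
        (fun j => mul_nonneg (hw _) (by positivity)) (fun j => ?_) hs1
      have h1 : 0 ≤ w (j + 1) * ξ ^ (j + 1) := mul_nonneg (hw _) (by positivity)
      push_cast
      nlinarith [mul_nonneg (Nat.cast_nonneg j : (0 : ℝ) ≤ j) h1]
    rw [hπk k]
    refine tendsto_letterMean_of_rate_pos hw hw0 hw2 hξ hs0 (fun t ht hst => ?_) k
    refine tsum_mul_le_of_critical hw hξ ht hs1 hs0 hst (hcrit.imp_right fun h => ⟨?_, h.2⟩)
    have h1 := le_inv_wLimsup hw ht hst
    rw [← h.1] at h1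
    exact (ENNReal.ofReal_le_ofReal_iff hξ.le).1 h1

/-- under `ℙ^w_n`, the size of the block containing `1` converges in
distribution to the size-biased law `k ↦ k·π(k)`. -/
theorem stmt13 (w : ℕ → ℝ) (hw0 : w 0 = 1) (hw : ∀ i : ℕ, 0 ≤ w i)
    (hw2 : ∃ k : ℕ, 2 ≤ k ∧ 0 < w k)
    (π : ℕ → ℝ) (hπ : PiSpec w π)
    (k : ℕ) (hk : 1 ≤ k) :
    Filter.Tendsto
      (fun n : ℕ =>
        (∑ P ∈ (NCP n).filter fun P => ∃ B ∈ P, 1 ∈ B ∧ B.card = k, OmegaP w P) /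
          Zw w n)
      (Filter.atTop ⊓ Filter.principal {n : ℕ | 0 < Zw w n})
      (nhds ((k : ℝ) * π k)) := by
  have hZ : ∀ n, 1 ≤ n → powCoeff w (n + 1) n = (n + 1) * Zw w n := fun n hn => by
    rw [powCoeff_succ_eq hw0, Zw_eq_forest w hw0 hn]
  have hfilter : Filter.atTop ⊓ Filter.principal {n : ℕ | 0 < Zw w n} ≤ admissible w := by
    refine le_inf inf_le_left (Filter.le_principal_iff.2 ?_)
    refine Filter.eventually_inf_principal.2 ?_
    filter_upwards [Filter.eventually_ge_atTop 1] with n hn hpos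
    rw [hZ n hn]
    exact mul_pos (by positivity) hpos
  refine Filter.Tendsto.congr' ?_
    (((tendsto_letterMean hw0 hw hw2 hπ hk).mono_left hfilter).const_mul (k : ℝ))
  refine Filter.eventually_inf_principal.2 ?_
  filter_upwards [Filter.eventually_ge_atTop k] with n hn hpos
  have hn1 : 1 ≤ n := hk.trans hn
  have hn0 : (n : ℝ) ≠ 0 := by exact_mod_cast (by omega : n ≠ 0)
  have hpos' : Zw w n ≠ 0 := ne_of_gt hpos
  have hlag := mul_forest w hw0 n k (n - k) (by omega)
  rw [sum_rootBlock_card w hw0 hn1, letterMean, PowerSeries.coeff_X_pow_mul', if_pos hn, hZ n hn1,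
    ← powCoeff]
  have hn2 : (n : ℝ) + 1 ≠ 0 := by positivity
  field_simp
  linear_combination (-w k) * hlag
end
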